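/- arXiv:quant-ph/0503239 — 2 statements merged into one kernel-verified Lean document; each statement's English description precedes it below -/
import Mathlib

section
/- Fix an integer d ≥ 1. For an integer n ≥ 2 let p be the smallest prime with p ≥ n, let F_d be the set of polynomials f(X) = Σ_{ν=2}^{d+1} a_ν X^ν with integer coefficients 0 ≤ a_ν ≤ n−1, and for f ∈ F_d and 1 ≤ i ≤ n define ψ_{f,i} = n^{-1/2} (e_p(f(u)) e_n(i u))_{u=1}^{n} ∈ ℂ^n. Then: (i) for each f ∈ F_d, the set B_f = {ψ_{f,1}, ..., ψ_{f,n}} is an orthonormal basis of ℂ^n; (ii) |⟨e_u, ψ_{f,i}⟩| = n^{-1/2} for every standard basis vector e_u; (iii) there is a constant C (depending only on d) such that for all n ≥ 2, all distinct f, g ∈ F_d, and all 1 ≤ i, j ≤ n: |⟨ψ_{g,j}, ψ_{f,i}⟩| ≤ C n^{-1/3} if d = 1, and |⟨ψ_{g,j}, ψ_{f,i}⟩| ≤ C n^{-1/4} if d ≥ 2. -/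
open scoped ComplexInnerProductSpace

/-- `e_m(z) = exp(2 π i z / m)` for an integer `z`. -/
noncomputable def eInt (m : ℕ) (z : ℤ) : ℂ :=
  Complex.exp (2 * Real.pi * Complex.I * (z : ℂ) / m)

theorem Multiset.mul_esymm_eq_sum_range {R : Type*} [CommRing R] (s : Multiset R) (k : ℕ) :
    (k : R) * s.esymm k = (-1) ^ (k + 1) *
      ∑ i ∈ Finset.range k, (-1) ^ i * s.esymm i * (s.map (· ^ (k - i))).sum := by
  obtain ⟨l, rfl⟩ := Quot.exists_rep s
  have hl : (Multiset.map l.get (Finset.univ : Finset (Fin l.length)).1) = (l : Multiset R) := by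
    simp
  have h := congrArg (MvPolynomial.aeval (R := R) l.get)
    (MvPolynomial.mul_esymm_eq_sum (Fin l.length) R k)
  have hp : ∀ j, MvPolynomial.aeval (R := R) l.get (MvPolynomial.psum (Fin l.length) R j) =
      ((l : Multiset R).map (· ^ j)).sum := by
    intro j
    rw [← hl, Multiset.map_map, MvPolynomial.psum, map_sum, Finset.sum]
    simp only [map_pow, MvPolynomial.aeval_X, Function.comp_def]
  simp only [map_mul, map_natCast, map_pow, map_neg, map_one, map_sum,
    MvPolynomial.aeval_esymm_eq_multiset_esymm, hp, hl] at h
  refine h.trans (congrArg _ ?_)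
  rw [Finset.sum_filter, Finset.Nat.sum_antidiagonal_eq_sum_range_succ_mk, Finset.sum_range_succ]
  simp only [lt_irrefl, if_false, add_zero]
  exact Finset.sum_congr rfl fun i hi => if_pos (Finset.mem_range.1 hi)

open Polynomial in
theorem norm_le_of_norm_sum_pow_le {s : Multiset ℂ} {B C : ℝ} (hB : 0 ≤ B)
    (h : ∀ r : ℕ, 1 ≤ r → ‖(s.map (· ^ r)).sum‖ ≤ C * B ^ r) {z : ℂ} (hz : z ∈ s) :
    ‖z‖ ≤ B := by
  classical
  set g : ℂ[X] := ∏ w ∈ s.toFinset.erase z, (X - Polynomial.C w) with hg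
  have hgz : g.eval z ≠ 0 := by
    rw [hg, eval_prod, Finset.prod_ne_zero_iff]
    intro w hw
    simpa [sub_eq_zero] using (Finset.ne_of_mem_erase hw).symm
  have key : ∀ r, (s.map fun w => w ^ r * g.eval w).sum = s.count z * (z ^ r * g.eval z) := by
    intro r
    rw [Finset.sum_multiset_map_count, Finset.sum_eq_single z]
    · simp
    · intro w hw hwz
      have : g.eval w = 0 := by
        rw [hg, eval_prod]
        exact Finset.prod_eq_zero (Finset.mem_erase.2 ⟨hwz, hw⟩) (by simp)
      simp [this]
    · intro hn
      exact absurd (Multiset.mem_toFinset.2 hz) hn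
  have key2 : ∀ r, (s.map fun w => w ^ r * g.eval w).sum =
      ∑ j ∈ Finset.range (g.natDegree + 1), g.coeff j * (s.map (· ^ (r + j))).sum := by
    intro r
    clear hz hgz key h
    clear_value g
    clear hg
    induction s using Multiset.induction with
    | empty => simp
    | cons a t ih =>
      simp only [Multiset.map_cons, Multiset.sum_cons, ih, mul_add, Finset.sum_add_distrib]
      rw [eval_eq_sum_range, Finset.mul_sum]
      congr 1
      exact Finset.sum_congr rfl fun j _ => by ring
  set c : ℝ := s.count z * ‖g.eval z‖ with hc
  have hc0 : 0 < c := by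
    have := Multiset.count_pos.2 hz
    positivity
  set D : ℝ := ∑ j ∈ Finset.range (g.natDegree + 1), ‖g.coeff j‖ * (C * B ^ j) with hD
  have bound : ∀ r : ℕ, 1 ≤ r → c * ‖z‖ ^ r ≤ D * B ^ r := by
    intro r hr
    have : c * ‖z‖ ^ r = ‖(s.map fun w => w ^ r * g.eval w).sum‖ := by
      rw [key]; simp [hc]; ring
    rw [this, key2, hD, Finset.sum_mul]
    refine (norm_sum_le _ _).trans (Finset.sum_le_sum fun j _ => ?_)
    rw [norm_mul, mul_assoc]
    refine mul_le_mul_of_nonneg_left ((h _ (by omega)).trans_eq ?_) (norm_nonneg _)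
    rw [pow_add]; ring
  by_contra! hlt
  rcases hB.eq_or_lt with rfl | hB
  · have := bound 1 le_rfl
    simp at this
    nlinarith [mul_pos hc0 hlt]
  have hx : 1 < ‖z‖ / B := (one_lt_div hB).2 hlt
  obtain ⟨r, hr⟩ := pow_unbounded_of_one_lt (D / c) hx
  have h1 : D / c < (‖z‖ / B) ^ (r + 1) := hr.trans_le (pow_le_pow_right₀ hx.le (by omega))
  rw [div_pow, div_lt_div_iff₀ hc0 (by positivity)] at h1
  have := bound (r + 1) (by omega)
  linarith [mul_comm c (‖z‖ ^ (r+1))]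

open Polynomial in
theorem natDegree_sum_pow_pow {L : Type*} [Field L] {p : ℕ} (hp : 1 < p) {f : L[X]}
    (hf : 1 ≤ f.natDegree) (t : ℕ) :
    (∑ i ∈ Finset.range (t + 1), f ^ p ^ i).natDegree = f.natDegree * p ^ t := by
  induction t with
  | zero => simp
  | succ t ih =>
    rw [Finset.sum_range_succ, natDegree_add_eq_right_of_natDegree_lt, natDegree_pow, mul_comm]
    rw [ih, natDegree_pow, mul_comm]
    exact Nat.mul_lt_mul_of_pos_right (Nat.pow_lt_pow_right hp (Nat.lt_succ_self t)) hf

theorem stepanov_exponent_injective {p A k i i' a a' b b' : ℕ} (hp : p.Prime) (hk : ¬ p ∣ k)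
    (hi : i < A) (hi' : i' < A) (hb : b < p) (hb' : b' < p)
    (h : i + a * (p * A) + b * (k * A) = i' + a' * (p * A) + b' * (k * A)) :
    i = i' ∧ a = a' ∧ b = b' := by
  have e1 : i + A * (a * p + b * k) = i' + A * (a' * p + b' * k) := by linarith
  have hii : i = i' := by
    have := congrArg (· % A) e1
    simpa [Nat.add_mul_mod_self_left, Nat.mod_eq_of_lt hi, Nat.mod_eq_of_lt hi'] using this
  subst hii
  have e2 : a * p + b * k = a' * p + b' * k :=
    Nat.eq_of_mul_eq_mul_left (by omega) (Nat.add_left_cancel e1)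
  have hbb : b = b' := by
    have h1 : b * k ≡ b' * k [MOD p] := by
      have := congrArg (· % p) e2
      simpa [Nat.ModEq] using this
    have h2 := Nat.ModEq.cancel_right_of_coprime ((hp.coprime_iff_not_dvd.2 hk)) h1
    simpa [Nat.ModEq, Nat.mod_eq_of_lt hb, Nat.mod_eq_of_lt hb'] using h2
  subst hbb
  exact ⟨rfl, Nat.eq_of_mul_eq_mul_right hp.pos (Nat.add_right_cancel e2), rfl⟩

open Polynomial in
theorem card_le_of_sum_pow_eval_eq {L : Type*} [Field L] [IsAlgClosed L] {p : ℕ}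
    [hp : Fact p.Prime] [CharP L p] {f : L[X]} (hf : ¬ p ∣ f.natDegree) (t : ℕ) (c : L)
    (Z : Finset L) (hZ : ∀ x ∈ Z, x ^ p ^ (2 * (t + 1)) = x)
    (hZc : ∀ x ∈ Z, ∑ i ∈ Finset.range (2 * (t + 1)), (f.eval x) ^ p ^ i = c) :
    Z.card ≤ p ^ (2 * t + 1) + (3 * f.natDegree + 1) * p ^ (t + 1) := by
  set k := f.natDegree with hkdef
  have hk1 : 1 ≤ k := Nat.one_le_iff_ne_zero.2 fun h => hf (h ▸ dvd_zero p)
  have hp2 := hp.out.two_le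
  set A := p ^ t with hA
  have hA1 : 1 ≤ A := Nat.one_le_pow _ _ hp.out.pos
  set Q := p ^ (t + 1) with hQ
  have hQA : Q = p * A := by rw [hQ, hA, pow_succ, mul_comm]
  set B := A + 2 * k with hB
  set T : L[X] := ∑ i ∈ Finset.range (t + 1), f ^ p ^ i with hT
  have hTdeg : T.natDegree = k * A := natDegree_sum_pow_pow hp.out.one_lt hk1 t
  have hT0 : T ≠ 0 := by
    intro h
    rw [h, natDegree_zero] at hTdeg
    exact absurd hTdeg (Nat.mul_pos hk1 hA1).ne
  let ι := Fin A × Fin B × Fin p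
  set D := (A - 1) * Q + B + p * (k * A) with hD
  let E : ι → L[X] := fun j => X ^ ((j.1 : ℕ) * Q + j.2.1) * (C c - T) ^ (j.2.2 : ℕ)
  have hE : ∀ j, E j ∈ degreeLT L D := by
    rintro ⟨i, a, b⟩
    rw [mem_degreeLT]
    refine lt_of_le_of_lt degree_le_natDegree (WithBot.coe_lt_coe.2 ?_)
    refine lt_of_le_of_lt natDegree_mul_le ?_
    rw [natDegree_X_pow]
    have h1 : ((C c - T) ^ (b : ℕ)).natDegree ≤ p * (k * A) := by
      refine natDegree_pow_le.trans (Nat.mul_le_mul b.2.le ?_)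
      refine (natDegree_sub_le _ _).trans ?_
      simp [hTdeg]
    have h2 : (i : ℕ) * Q ≤ (A - 1) * Q := Nat.mul_le_mul_right _ (by omega)
    have h3 : (a : ℕ) < B := a.2
    rw [hD]
    exact add_lt_add_of_lt_of_le (add_lt_add_of_le_of_lt h2 h3) h1
  obtain ⟨τ, hτ, j₀, hj₀⟩ : ∃ τ : ι → L, ∑ j, τ j • E j = 0 ∧ ∃ j, τ j ≠ 0 := by
    rw [← Fintype.not_linearIndependent_iff]
    intro hli
    have hli' : LinearIndependent L (fun j => (⟨E j, hE j⟩ : degreeLT L D)) :=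
      LinearIndependent.of_comp (degreeLT L D).subtype hli
    have : FiniteDimensional L (degreeLT L D) := (degreeLTEquiv L D).symm.finiteDimensional
    have := hli'.fintype_card_le_finrank
    rw [(degreeLTEquiv L D).finrank_eq] at this
    simp only [ι, Fintype.card_prod, Fintype.card_fin, Module.finrank_fin_fun] at this
    obtain ⟨A', hA'⟩ : ∃ A', A = A' + 1 := ⟨A - 1, by omega⟩
    rw [hD, hB, hQA, hA'] at this
    simp only [Nat.add_sub_cancel] at this
    have h1 : 2 * (A' + 1) ≤ p * (A' + 1) := Nat.mul_le_mul_right _ hp2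
    have h2 : k * 2 ≤ k * (p * (A' + 1)) := Nat.mul_le_mul_left _ (by omega)
    linarith
  let τ' : ι → L := fun j => (iterateFrobeniusEquiv L p (t + 1)).symm (τ j)
  have hτ' : ∀ j, τ' j ^ Q = τ j := by
    intro j
    have := (iterateFrobeniusEquiv L p (t + 1)).apply_symm_apply (τ j)
    rwa [iterateFrobeniusEquiv_apply, iterateFrobenius_def] at this
  let W : ι → L[X] := fun j => C (τ' j) * X ^ ((j.1 : ℕ) + j.2.1 * Q) * T ^ (j.2.2 : ℕ)
  have hWdeg : ∀ j, W j ≠ 0 →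
      (W j).natDegree = (j.1 : ℕ) + j.2.1 * Q + j.2.2 * (k * A) := by
    intro j hj
    have h0 : τ' j ≠ 0 := by
      intro h; exact hj (by simp [W, h])
    simp only [W]
    rw [mul_assoc, natDegree_C_mul h0, natDegree_mul (pow_ne_zero _ X_ne_zero) (pow_ne_zero _ hT0),
      natDegree_pow, natDegree_pow,
      natDegree_X, mul_one, hTdeg]
  have hWj₀ : W j₀ ≠ 0 := by
    have : τ' j₀ ≠ 0 := by
      intro h
      apply hj₀
      rw [← hτ', h, zero_pow (by positivity)]
    exact mul_ne_zero (mul_ne_zero (C_ne_zero.2 this) (pow_ne_zero _ X_ne_zero))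
      (pow_ne_zero _ hT0)
  set w := ∑ j, W j with hw
  have hw0 : w ≠ 0 := by
    have h1 := degree_sum_eq_of_disjoint W Finset.univ (by
      rintro j ⟨-, hj⟩ j' ⟨-, hj'⟩ hne heq
      apply hne
      have h2 : (W j).natDegree = (W j').natDegree := by simp only [natDegree]; exact congrArg _ heq
      rw [hWdeg j hj, hWdeg j' hj', hQA] at h2
      obtain ⟨h3, h4, h5⟩ := stepanov_exponent_injective hp.out hf j.1.2 j'.1.2 j.2.2.2 j'.2.2.2 h2
      exact Prod.ext (Fin.ext h3) (Prod.ext (Fin.ext h4) (Fin.ext h5)))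
    intro hw0
    rw [← hw, hw0, degree_zero] at h1
    have h2 := Finset.le_sup (f := fun j => degree (W j)) (Finset.mem_univ j₀)
    rw [← h1, le_bot_iff, degree_eq_bot] at h2
    exact hWj₀ h2
  have hroot : ∀ x ∈ Z, w.eval x = 0 := by
    intro x hx
    have hxQ : (x ^ Q) ^ Q = x := by
      rw [← pow_mul, hQ, ← pow_add, ← two_mul]; exact hZ x hx
    have hTQ : (T.eval x) ^ Q = c - T.eval x := by
      rw [eq_sub_iff_add_eq', ← hZc x hx, two_mul (t + 1), Finset.sum_range_add, hT,
        eval_finsetSum, hQ, sum_pow_char_pow]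
      simp_rw [eval_pow, ← pow_mul, ← pow_add, add_comm (t + 1)]
    have h1 : (w.eval x) ^ Q = (∑ j, τ j • E j).eval x := by
      rw [hw, eval_finsetSum, eval_finsetSum, hQ, sum_pow_char_pow]
      refine Finset.sum_congr rfl fun j _ => ?_
      rw [← hQ]
      simp only [W, E, eval_mul, eval_C, eval_pow, eval_X, eval_smul, eval_sub, smul_eq_mul,
        mul_pow, hτ', ← hTQ]
      rw [mul_assoc]
      congr 2
      · rw [← pow_mul, add_mul, pow_add, pow_add, mul_assoc, mul_comm (j.2.1 : ℕ),
          pow_mul x (Q * Q), pow_mul x Q, hxQ]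
      · rw [← pow_mul, ← pow_mul, mul_comm]
    rw [hτ, eval_zero] at h1
    exact pow_eq_zero_iff (by positivity) |>.1 h1
  calc Z.card ≤ w.natDegree := by
        refine card_le_degree_of_subset_roots (fun x hx => ?_)
        rw [mem_roots hw0]
        exact hroot x hx
    _ ≤ A + (A + 2 * k) * Q + p * (k * A) := by
        refine natDegree_sum_le_of_forall_le _ _ fun j _ => ?_
        by_cases hj : W j = 0
        · simp [hj]
        rw [hWdeg j hj]
        exact add_le_add (add_le_add j.1.2.le (Nat.mul_le_mul_right _ j.2.1.2.le))
          (Nat.mul_le_mul_right _ j.2.2.2.le)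
    _ ≤ _ := by
        have : p ^ (2 * t + 1) = A * Q := by rw [hA, hQ, ← pow_add]; congr 1; ring
        rw [this]
        have : A ≤ Q := by nlinarith
        have : p * (k * A) = k * Q := by rw [hQA]; ring
        rw [this]
        nlinarith

open Polynomial in
/-- The elements of an algebraically closed field of characteristic `p` fixed by the `r`-th power
of Frobenius, that is, the field with `p ^ r` elements. -/
noncomputable def frobeniusFixed (L : Type*) [Field L] (p r : ℕ) : Finset L :=
  by classical exact (X ^ p ^ r - X : L[X]).roots.toFinset

section FrobeniusFixed

variable {L : Type*} [Field L] {p : ℕ} [hp : Fact p.Prime]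

open Polynomial

theorem mem_frobeniusFixed {r : ℕ} (hr : 1 ≤ r) {x : L} :
    x ∈ frobeniusFixed L p r ↔ x ^ p ^ r = x := by
  have h0 : (X ^ p ^ r - X : L[X]) ≠ 0 :=
    FiniteField.X_pow_card_pow_sub_X_ne_zero L (by omega) hp.out.one_lt
  simp [frobeniusFixed, mem_roots h0, sub_eq_zero]

theorem card_frobeniusFixed [IsAlgClosed L] [CharP L p] {r : ℕ} (hr : 1 ≤ r) :
    (frobeniusFixed L p r).card = p ^ r := by
  classical
  have hsep : (X ^ p ^ r - X : L[X]).Separable :=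
    galois_poly_separable p (p ^ r) (dvd_pow_self p (by omega))
  rw [frobeniusFixed, Multiset.toFinset_card_of_nodup (nodup_roots hsep),
    splits_iff_card_roots.1 (IsAlgClosed.splits _),
    FiniteField.X_pow_card_pow_sub_X_natDegree_eq L (by omega) hp.out.one_lt]

theorem aeval_pow_pow [Algebra (ZMod p) L] (f : (ZMod p)[X]) (x : L) (i : ℕ) :
    aeval x f ^ p ^ i = aeval (x ^ p ^ i) f := by
  have h := map_iterateFrobenius_expand p f i
  have h1 : f.map (iterateFrobenius (ZMod p) p i) = f := by
    have : iterateFrobenius (ZMod p) p i = RingHom.id _ := RingHom.ext_zmod _ _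
    rw [this, Polynomial.map_id]
  rw [map_expand, h1] at h
  rw [← map_pow, ← h, expand_aeval]

theorem sum_pow_pow_pow_eq [CharP L p] {x : L} {r : ℕ} (hx : x ^ p ^ r = x) :
    (∑ i ∈ Finset.range r, x ^ p ^ i) ^ p = ∑ i ∈ Finset.range r, x ^ p ^ i := by
  have h := Finset.sum_range_succ (fun i => x ^ p ^ i) r
  rw [Finset.sum_range_succ', hx, pow_zero, pow_one] at h
  rw [sum_pow_char]
  simp_rw [← pow_mul, ← pow_succ]
  exact add_right_cancel h

variable [IsAlgClosed L] [CharP L p] [Algebra (ZMod p) L]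

theorem image_algebraMap_eq_frobeniusFixed_one [DecidableEq L] :
    Finset.univ.image (algebraMap (ZMod p) L) = frobeniusFixed L p 1 := by
  refine Finset.eq_of_subset_of_card_le (fun y hy => ?_) ?_
  · obtain ⟨c, -, rfl⟩ := Finset.mem_image.1 hy
    rw [mem_frobeniusFixed le_rfl, pow_one, ← map_pow, ZMod.pow_card]
  · rw [card_frobeniusFixed le_rfl,
      Finset.card_image_of_injective _ (algebraMap (ZMod p) L).injective]
    simp

theorem exists_algebraMap_eq_of_pow_eq {y : L} (hy : y ^ p = y) :
    ∃ c : ZMod p, algebraMap (ZMod p) L c = y := by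
  classical
  have : y ∈ frobeniusFixed L p 1 := by rwa [mem_frobeniusFixed le_rfl, pow_one]
  rw [← image_algebraMap_eq_frobeniusFixed_one] at this
  simpa using this

/-- The exponential sum of `f` over the field with `p ^ r` elements. -/
noncomputable def expSum (Φ : AddChar L ℂ) (f : (ZMod p)[X]) (r : ℕ) : ℂ :=
  ∑ x ∈ frobeniusFixed L p r, Φ (∑ i ∈ Finset.range r, aeval (x ^ p ^ i) f)

theorem norm_expSum_le {Φ : AddChar L ℂ} {χ : AddChar (ZMod p) ℂ} (hχ : χ ≠ 1)
    (hΦ : ∀ a, Φ (algebraMap (ZMod p) L a) = χ a) {f : (ZMod p)[X]} (hf : ¬ p ∣ f.natDegree)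
    (t : ℕ) :
    ‖expSum Φ f (2 * (t + 1))‖ ≤ p * (3 * f.natDegree + 1) * p ^ (t + 1) := by
  classical
  set G := frobeniusFixed L p (2 * (t + 1)) with hG
  have hmem : ∀ x ∈ G, x ^ p ^ (2 * (t + 1)) = x := fun x hx =>
    (mem_frobeniusFixed (by omega)).1 hx
  have hc : ∀ x : L, ∃ c : ZMod p, x ∈ G →
      algebraMap (ZMod p) L c = ∑ i ∈ Finset.range (2 * (t + 1)), aeval (x ^ p ^ i) f := by
    intro x
    by_cases hx : x ∈ G
    · obtain ⟨c, hc⟩ := exists_algebraMap_eq_of_pow_eq (L := L) (p := p)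
        (sum_pow_pow_pow_eq (x := aeval x f) (r := 2 * (t + 1))
          (by rw [aeval_pow_pow, hmem x hx]))
      refine ⟨c, fun _ => hc.trans ?_⟩
      simp_rw [aeval_pow_pow]
    · exact ⟨0, fun h => absurd h hx⟩
  choose c hc using hc
  set N : ZMod p → ℕ := fun a => (G.filter fun x => c x = a).card with hN
  set M : ℕ := p ^ (2 * t + 1) + (3 * f.natDegree + 1) * p ^ (t + 1) with hM
  have hNM : ∀ a, N a ≤ M := by
    intro a
    have hdeg : (f.map (algebraMap (ZMod p) L)).natDegree = f.natDegree := natDegree_map _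
    have := card_le_of_sum_pow_eval_eq (f := f.map (algebraMap (ZMod p) L)) (by rwa [hdeg]) t
      (algebraMap (ZMod p) L a) (G.filter fun x => c x = a)
      (fun x hx => hmem x (Finset.mem_filter.1 hx).1) (fun x hx => by
        obtain ⟨hxG, rfl⟩ := Finset.mem_filter.1 hx
        rw [hc x hxG]
        simp_rw [eval_map_algebraMap, aeval_pow_pow])
    rwa [hdeg] at this
  have hS : expSum Φ f (2 * (t + 1)) = ∑ a, (N a : ℂ) * χ a := by
    rw [expSum, ← Finset.sum_fiberwise _ c]
    refine Finset.sum_congr rfl fun a _ => ?_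
    rw [hN, ← nsmul_eq_mul, ← Finset.sum_const]
    refine Finset.sum_congr rfl fun x hx => ?_
    obtain ⟨hxG, rfl⟩ := Finset.mem_filter.1 hx
    rw [← hΦ, hc x hxG]
  have hsum : ∑ a, N a = p ^ (2 * (t + 1)) := by
    rw [← card_frobeniusFixed (L := L) (p := p) (r := 2 * (t + 1)) (by omega), ← hG,
      Finset.card_eq_sum_card_fiberwise (f := c) (t := Finset.univ) (fun _ _ => by simp)]
  have hS' : expSum Φ f (2 * (t + 1)) = -∑ a, ((M : ℂ) - N a) * χ a := by
    simp_rw [sub_mul, Finset.sum_sub_distrib, ← Finset.mul_sum]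
    rw [AddChar.sum_eq_zero_of_ne_one hχ, hS]
    ring
  rw [hS', norm_neg]
  calc _ ≤ ∑ a, ((M : ℝ) - N a) := by
        refine norm_sum_le_of_le _ fun a _ => ?_
        have h1 : ‖χ a‖ = 1 := AddChar.norm_apply χ a
        have h2 : (0 : ℝ) ≤ M - N a := sub_nonneg.2 (by exact_mod_cast hNM a)
        have h3 : (M : ℂ) - N a = ((M - N a : ℝ) : ℂ) := by push_cast; rfl
        rw [norm_mul, h1, mul_one, h3, Complex.norm_real, Real.norm_of_nonneg h2]
    _ = p * M - p ^ (2 * (t + 1)) := by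
        have hsum' : ∑ a, (N a : ℝ) = p ^ (2 * (t + 1)) := by exact_mod_cast hsum
        rw [Finset.sum_sub_distrib, hsum']
        simp
    _ = _ := by
        rw [hM]; push_cast; ring

end FrobeniusFixed

section LFunction

variable {L : Type*} [Field L] {p : ℕ} [hp : Fact p.Prime]

open Polynomial

theorem esymm_sub_esymm_of_forall_lt {R : Type*} [CommRing R] {s s' : Multiset R} {k : ℕ}
    (hk : 1 ≤ k) (h : ∀ j < k, s'.esymm j = s.esymm j) :
    (∀ j, 1 ≤ j → j < k → (s'.map (· ^ j)).sum = (s.map (· ^ j)).sum) ∧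
    (s'.map (· ^ k)).sum - (s.map (· ^ k)).sum =
      (-1) ^ (k + 1) * k * (s'.esymm k - s.esymm k) := by
  induction k using Nat.strong_induction_on with
  | _ k ih =>
    have h1 : ∀ j, 1 ≤ j → j < k → (s'.map (· ^ j)).sum = (s.map (· ^ j)).sum := by
      intro j hj hjk
      have := (ih j hjk hj fun i hi => h i (hi.trans hjk)).2
      rwa [h j hjk, sub_self, mul_zero, sub_eq_zero] at this
    refine ⟨h1, ?_⟩
    have e := s.mul_esymm_eq_sum_range k
    have e' := s'.mul_esymm_eq_sum_range k
    obtain ⟨m, rfl⟩ : ∃ m, k = m + 1 := ⟨k - 1, by omega⟩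
    rw [Finset.sum_range_succ'] at e e'
    have hs : ∑ i ∈ Finset.range m, (-1) ^ (i + 1) * s'.esymm (i + 1) *
          (s'.map (· ^ (m + 1 - (i + 1)))).sum =
        ∑ i ∈ Finset.range m, (-1) ^ (i + 1) * s.esymm (i + 1) *
          (s.map (· ^ (m + 1 - (i + 1)))).sum := by
      refine Finset.sum_congr rfl fun i hi => ?_
      have := Finset.mem_range.1 hi
      rw [h (i + 1) (by omega), h1 _ (by omega) (by omega)]
    rw [hs] at e'
    have hsign : ((-1 : R) ^ (m + 1 + 1)) * (-1) ^ (m + 1 + 1) = 1 := by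
      rw [← mul_pow]; simp
    have h0 : ∀ u : Multiset R, u.esymm 0 = 1 := fun u => by simp [Multiset.esymm]
    simp only [pow_zero, h0, one_mul, Nat.sub_zero] at e e'
    rw [mul_assoc, mul_sub, e, e', ← mul_sub, ← mul_assoc, hsign]
    ring

theorem finite_monic_frobenius_invariant (L : Type*) [Field L] [IsAlgClosed L] (p : ℕ)
    [hp : Fact p.Prime] [CharP L p] [Algebra (ZMod p) L] (n : ℕ) :
    {g : L[X] | g.Monic ∧ g.natDegree = n ∧ g.map (frobenius L p) = g}.Finite := by
  refine (Set.finite_range fun c : Fin (n + 1) → ZMod p =>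
    ∑ i : Fin (n + 1), C (algebraMap (ZMod p) L (c i)) * X ^ (i : ℕ)).subset ?_
  rintro g ⟨-, hn, hg⟩
  have hc : ∀ i : Fin (n + 1), ∃ c : ZMod p, algebraMap (ZMod p) L c = g.coeff i := by
    intro i
    apply exists_algebraMap_eq_of_pow_eq
    conv_rhs => rw [← hg]
    rw [coeff_map, frobenius_def]
  choose c hc using hc
  refine ⟨c, ?_⟩
  simp only [hc]
  rw [Fin.sum_univ_eq_sum_range (fun i => C (g.coeff i) * X ^ i), ← hn,
    ← g.as_sum_range_C_mul_X_pow]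

/-- The completely multiplicative function attached to `f`. -/
noncomputable def rootChar [Algebra (ZMod p) L] (Φ : AddChar L ℂ) (f : (ZMod p)[X])
    (g : L[X]) : ℂ :=
  Φ (g.roots.map fun x => aeval x f).sum

theorem rootChar_mul [Algebra (ZMod p) L] (Φ : AddChar L ℂ) (f : (ZMod p)[X])
    {g h : L[X]} (hg : g.Monic) (hh : h.Monic) :
    rootChar Φ f (g * h) = rootChar Φ f g * rootChar Φ f h := by
  rw [rootChar, roots_mul (mul_ne_zero hg.ne_zero hh.ne_zero), Multiset.map_add, Multiset.sum_add,
    AddChar.map_add_eq_mul, rootChar, rootChar]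

theorem sum_map_aeval_eq [Algebra (ZMod p) L] (f : (ZMod p)[X]) (s : Multiset L) :
    (s.map fun x => aeval x f).sum =
      ∑ j ∈ Finset.range (f.natDegree + 1),
        algebraMap (ZMod p) L (f.coeff j) * (s.map (· ^ j)).sum := by
  induction s using Multiset.induction with
  | empty => simp
  | cons a t ih =>
    simp only [Multiset.map_cons, Multiset.sum_cons, ih, mul_add, Finset.sum_add_distrib]
    rw [aeval_eq_sum_range]
    simp [Algebra.smul_def]

variable [IsAlgClosed L] [CharP L p] [Algebra (ZMod p) L]

variable (L p) in
/-- Monic polynomials of degree `n` over `L` with coefficients in the prime field. -/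
noncomputable def monicFixed (n : ℕ) : Finset L[X] :=
  (finite_monic_frobenius_invariant L p n).toFinset

theorem mem_monicFixed {n : ℕ} {g : L[X]} :
    g ∈ monicFixed L p n ↔ g.Monic ∧ g.natDegree = n ∧ g.map (frobenius L p) = g := by
  simp [monicFixed]

/-- Coefficients of the `L`-function. -/
noncomputable def lCoeff (Φ : AddChar L ℂ) (f : (ZMod p)[X]) (n : ℕ) : ℂ :=
  ∑ g ∈ monicFixed L p n, rootChar Φ f g

theorem lCoeff_zero (Φ : AddChar L ℂ) (f : (ZMod p)[X]) : lCoeff Φ f 0 = 1 := by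
  have : monicFixed L p 0 = {1} := by
    ext g
    rw [mem_monicFixed, Finset.mem_singleton]
    constructor
    · rintro ⟨h1, h2, -⟩
      exact h1.natDegree_eq_zero.1 h2
    · rintro rfl
      simp
  simp [lCoeff, this, rootChar]

theorem esymm_roots_of_monic {g : L[X]} (hg : g.Monic) {j : ℕ} (hj : j ≤ g.natDegree) :
    g.roots.esymm j = (-1) ^ j * g.coeff (g.natDegree - j) := by
  have h := coeff_eq_esymm_roots_of_splits (IsAlgClosed.splits g)
    (Nat.sub_le g.natDegree j)
  rw [h, hg.leadingCoeff, one_mul, Nat.sub_sub_self hj, ← mul_assoc, ← mul_pow]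
  simp

theorem lCoeff_eq_zero {Φ : AddChar L ℂ} {χ : AddChar (ZMod p) ℂ} (hχ : χ ≠ 1)
    (hΦ : ∀ a, Φ (algebraMap (ZMod p) L a) = χ a) {f : (ZMod p)[X]} (hf : ¬ p ∣ f.natDegree)
    {n : ℕ} (hn : f.natDegree ≤ n) : lCoeff Φ f n = 0 := by
  set k := f.natDegree with hk
  have hk1 : 1 ≤ k := Nat.one_le_iff_ne_zero.2 fun h => hf (h ▸ dvd_zero p)
  have hk0 : (k : ZMod p) ≠ 0 := by rwa [Ne, ZMod.natCast_eq_zero_iff]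
  have hf0 : f.leadingCoeff ≠ 0 := by
    rw [leadingCoeff_ne_zero]; rintro rfl; simp at hk; omega
  obtain ⟨b, hb⟩ := AddChar.ne_one_iff.1 hχ
  set c : ZMod p := -b / (k * f.leadingCoeff) with hc
  have hcb : f.leadingCoeff * (-(k * c)) = b := by
    rw [hc]; field_simp
  set q : L[X] := C (algebraMap (ZMod p) L c) * X ^ (n - k) with hq
  have hqdeg : q.degree < n := (degree_C_mul_X_pow_le _ _).trans_lt (by exact_mod_cast (by omega))
  have hqF : q.map (frobenius L p) = q := by
    rw [hq, Polynomial.map_mul, map_C, Polynomial.map_pow, map_X, frobenius_def, ← map_pow,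
      ZMod.pow_card]
  have key : ∀ g ∈ monicFixed L p n, g + q ∈ monicFixed L p n ∧ g - q ∈ monicFixed L p n := by
    intro g hg
    obtain ⟨h1, h2, h3⟩ := mem_monicFixed.1 hg
    have hdeg : q.degree < g.degree := by rwa [degree_eq_natDegree h1.ne_zero, h2]
    refine ⟨mem_monicFixed.2 ⟨h1.add_of_left hdeg, ?_, ?_⟩,
      mem_monicFixed.2 ⟨h1.sub_of_left hdeg, ?_, ?_⟩⟩
    · rw [natDegree_add_eq_left_of_degree_lt hdeg, h2]
    · rw [Polynomial.map_add, h3, hqF]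
    · rw [natDegree_eq_of_degree_eq (degree_sub_eq_left_of_degree_lt hdeg), h2]
    · rw [Polynomial.map_sub, h3, hqF]
  have hshift : ∀ g ∈ monicFixed L p n, rootChar Φ f (g + q) = χ b * rootChar Φ f g := by
    intro g hg
    obtain ⟨h1, h2, -⟩ := mem_monicFixed.1 hg
    obtain ⟨h1', h2', -⟩ := mem_monicFixed.1 (key g hg).1
    have he : ∀ j ≤ n, (g + q).roots.esymm j - g.roots.esymm j =
        if j = k then (-1) ^ j * algebraMap (ZMod p) L c else 0 := by
      intro j hj
      rw [esymm_roots_of_monic h1 (h2 ▸ hj), esymm_roots_of_monic h1' (h2' ▸ hj), h2, h2',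
        coeff_add, hq, coeff_C_mul, coeff_X_pow, ← mul_sub, add_sub_cancel_left]
      have : n - j = n - k ↔ j = k := by omega
      simp [this]
    obtain ⟨e1, e2⟩ := esymm_sub_esymm_of_forall_lt (s := g.roots) (s' := (g + q).roots) hk1
      (fun j hj => by
        have := he j (by omega)
        rwa [if_neg hj.ne, sub_eq_zero] at this)
    rw [he k hn, if_pos rfl] at e2
    have hsign : ((-1 : L) ^ (k + 1)) * (-1) ^ k = -1 := by
      rw [← pow_add, show k + 1 + k = 2 * k + 1 by ring, pow_succ, pow_mul]; simp
    have e3 : ((g + q).roots.map fun x => aeval x f).sum =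
        (g.roots.map fun x => aeval x f).sum + algebraMap (ZMod p) L b := by
      rw [sum_map_aeval_eq, sum_map_aeval_eq, Finset.sum_range_succ, Finset.sum_range_succ,
        ← hk, add_assoc]
      congr 1
      · refine Finset.sum_congr rfl fun j hj => ?_
        rw [Finset.mem_range] at hj
        rcases Nat.eq_zero_or_pos j with rfl | hj0
        · simp [splits_iff_card_roots.1 (IsAlgClosed.splits _), h2, h2']
        · rw [e1 j hj0 hj]
      · rw [sub_eq_iff_eq_add'.1 e2, mul_add, ← hcb]
        congr 1
        rw [map_mul, map_neg, map_mul, map_natCast, leadingCoeff, ← hk]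
        linear_combination (algebraMap (ZMod p) L (f.coeff k) * k * algebraMap (ZMod p) L c) * hsign
    rw [rootChar, e3, AddChar.map_add_eq_mul, hΦ, mul_comm, rootChar]
  have hsum : lCoeff Φ f n = χ b * lCoeff Φ f n := by
    conv_lhs => rw [lCoeff]
    rw [lCoeff, Finset.mul_sum]
    symm
    refine Finset.sum_nbij' (fun g => g + q) (fun g => g - q) (fun g hg => (key g hg).1)
      (fun g hg => (key g hg).2) (fun g _ => by ring) (fun g _ => by ring)
      (fun g hg => (hshift g hg).symm)
  have : (χ b - 1) * lCoeff Φ f n = 0 := by rw [sub_mul, ← hsum]; ring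
  exact (mul_eq_zero.1 this).resolve_left (sub_ne_zero.2 hb)

end LFunction

section LFunctionRecurrence

variable {L : Type*} [Field L] {p : ℕ}

open Polynomial

/-- The product of the linear factors at the first `r` Frobenius conjugates of `x`. -/
noncomputable def orbitPoly (p r : ℕ) (x : L) : L[X] :=
  ∏ i ∈ Finset.range r, (X - C (x ^ p ^ i))

theorem orbitPoly_monic (p r : ℕ) (x : L) : (orbitPoly p r x).Monic :=
  monic_prod_X_sub_C _ _

theorem natDegree_orbitPoly (p r : ℕ) (x : L) : (orbitPoly p r x).natDegree = r := by
  rw [orbitPoly, natDegree_finsetProd_X_sub_C_eq_card, Finset.card_range]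

theorem orbitPoly_mul {m : ℕ} {x : L} (hx : x ^ p ^ m = x) (j : ℕ) :
    orbitPoly p (m * j) x = orbitPoly p m x ^ j := by
  induction j with
  | zero => simp [orbitPoly]
  | succ j ih =>
    have hxj : x ^ p ^ (m * j) = x := by
      clear ih
      induction j with
      | zero => simp
      | succ j ih => rw [Nat.mul_succ, pow_add, pow_mul, ih, hx]
    rw [Nat.mul_succ, orbitPoly, Finset.prod_range_add, pow_succ, ← ih, orbitPoly, orbitPoly]
    congr 1
    refine Finset.prod_congr rfl fun i _ => ?_
    rw [pow_add, pow_mul, hxj]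

variable [hp : Fact p.Prime] [CharP L p]

theorem map_frobenius_orbitPoly {r : ℕ} {x : L} (hx : x ^ p ^ r = x) :
    (orbitPoly p r x).map (frobenius L p) = orbitPoly p r x := by
  have h := Finset.prod_range_succ (fun i => X - C (x ^ p ^ i)) r
  rw [Finset.prod_range_succ', hx, pow_zero, pow_one] at h
  have h' := mul_right_cancel₀ (X_sub_C_ne_zero x) h
  rw [orbitPoly, Polynomial.map_prod, ← h']
  refine Finset.prod_congr rfl fun i _ => ?_
  rw [Polynomial.map_sub, map_X, map_C, frobenius_def, ← pow_mul, ← pow_succ]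

theorem X_sub_C_pow_dvd_frobenius {g : L[X]} (hg : g.map (frobenius L p) = g) {x : L} {j : ℕ}
    (h : (X - C x) ^ j ∣ g) (i : ℕ) : (X - C (x ^ p ^ i)) ^ j ∣ g := by
  induction i with
  | zero => simpa
  | succ i ih =>
    have := Polynomial.map_dvd (frobenius L p) ih
    rwa [hg, Polynomial.map_pow, Polynomial.map_sub, map_X, map_C, frobenius_def, ← pow_mul,
      ← pow_succ] at this

theorem orbitPoly_pow_dvd_iff {g : L[X]} (hg : g.map (frobenius L p) = g) (hg0 : g ≠ 0) {x : L}
    (hm : 0 < Function.minimalPeriod (frobenius L p) x) (j : ℕ) :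
    orbitPoly p (Function.minimalPeriod (frobenius L p) x) x ^ j ∣ g ↔
      j ≤ g.rootMultiplicity x := by
  rw [le_rootMultiplicity_iff hg0]
  constructor
  · refine fun h => (pow_dvd_pow_of_dvd ?_ j).trans h
    rw [orbitPoly]
    have := Finset.dvd_prod_of_mem (fun i => X - C (x ^ p ^ i)) (Finset.mem_range.2 hm)
    simpa using this
  · intro h
    rw [orbitPoly, ← Finset.prod_pow]
    refine Finset.prod_dvd_of_coprime ?_ fun i _ => X_sub_C_pow_dvd_frobenius hg h i
    intro i hi i' hi' hne
    refine IsCoprime.pow (isCoprime_X_sub_C_of_isUnit_sub (IsUnit.mk0 _ (sub_ne_zero.2 ?_)))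
    intro heq
    refine hne (Function.iterate_injOn_Iio_minimalPeriod (f := frobenius L p) (x := x)
      (by simpa using hi) (by simpa using hi') ?_)
    simpa only [iterate_frobenius] using heq

theorem minimalPeriod_frobenius_pos {g : L[X]} (hg : g.map (frobenius L p) = g) (hg0 : g ≠ 0)
    {x : L} (hx : g.IsRoot x) : 0 < Function.minimalPeriod (frobenius L p) x := by
  classical
  have hroot : ∀ i, x ^ p ^ i ∈ g.roots.toFinset := by
    intro i
    have := X_sub_C_pow_dvd_frobenius hg (j := 1) (by rw [pow_one]; exact dvd_iff_isRoot.2 hx) i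
    rw [pow_one, dvd_iff_isRoot] at this
    simpa [hg0] using this
  obtain ⟨i, j, hne, heq⟩ := Finite.exists_ne_map_eq_of_infinite
    (fun i : ℕ => (⟨_, hroot i⟩ : g.roots.toFinset))
  wlog hij : i < j generalizing i j
  · exact this j i hne.symm heq.symm (by omega)
  have heq' : (frobenius L p)^[i] x = (frobenius L p)^[j] x := by
    simpa only [iterate_frobenius] using congrArg Subtype.val heq
  have hper : Function.IsPeriodicPt (frobenius L p) (j - i) x := by
    apply (frobenius_inj L p).iterate i
    rw [← Function.iterate_add_apply, Nat.add_sub_cancel' hij.le, heq']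
  exact hper.minimalPeriod_pos (by omega)

theorem card_orbitPoly_dvd [IsAlgClosed L] {n : ℕ} {g : L[X]}
    (hg : g.map (frobenius L p) = g) (hg0 : g ≠ 0) (hn : g.natDegree = n)
    {x : L} (hx : g.IsRoot x) [DecidableEq L]
    [DecidablePred fun r => x ∈ frobeniusFixed L p r ∧ orbitPoly p r x ∣ g] :
    ((Finset.Icc 1 n).filter fun r => x ∈ frobeniusFixed L p r ∧ orbitPoly p r x ∣ g).card =
      g.rootMultiplicity x := by
  set m := Function.minimalPeriod (frobenius L p) x with hmdef
  have hm : 0 < m := minimalPeriod_frobenius_pos hg hg0 hx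
  have hxm : x ^ p ^ m = x := by
    rw [← iterate_frobenius]; exact Function.iterate_minimalPeriod
  have hset : ((Finset.Icc 1 n).filter fun r => x ∈ frobeniusFixed L p r ∧ orbitPoly p r x ∣ g) =
      (Finset.Icc 1 (g.rootMultiplicity x)).image (m * ·) := by
    ext r
    simp only [Finset.mem_filter, Finset.mem_Icc, Finset.mem_image]
    constructor
    · rintro ⟨⟨hr1, -⟩, hxr, hdvd⟩
      rw [mem_frobeniusFixed hr1, ← iterate_frobenius] at hxr
      obtain ⟨j, rfl⟩ : m ∣ r := Function.IsPeriodicPt.minimalPeriod_dvd hxr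
      rw [orbitPoly_mul hxm, orbitPoly_pow_dvd_iff hg hg0 hm] at hdvd
      exact ⟨j, ⟨Nat.pos_of_mul_pos_left (a := m) (by omega), hdvd⟩, rfl⟩
    · rintro ⟨j, ⟨hj1, hj⟩, rfl⟩
      have hmj : 1 ≤ m * j := Nat.mul_pos hm hj1
      have hdvd : orbitPoly p (m * j) x ∣ g := by
        rwa [orbitPoly_mul hxm, orbitPoly_pow_dvd_iff hg hg0 hm]
      refine ⟨⟨hmj, ?_⟩, ?_, hdvd⟩
      · have := natDegree_le_of_dvd hdvd hg0
        rwa [natDegree_orbitPoly, hn] at this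
      · rw [mem_frobeniusFixed hmj, ← iterate_frobenius]
        exact (Function.isPeriodicPt_minimalPeriod _ _).mul_const j
  rw [hset, Finset.card_image_of_injective _ fun a b h => Nat.eq_of_mul_eq_mul_left hm h,
    Nat.card_Icc, Nat.add_sub_cancel]

variable [IsAlgClosed L] [Algebra (ZMod p) L]

theorem sum_card_orbitPoly_dvd {n : ℕ} {g : L[X]} (hg : g ∈ monicFixed L p n) [DecidableEq L]
    [∀ r x, Decidable (orbitPoly p r x ∣ g)] :
    ∑ r ∈ Finset.Icc 1 n,
      ((frobeniusFixed L p r).filter fun x => orbitPoly p r x ∣ g).card = n := by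
  obtain ⟨h1, h2, h3⟩ := mem_monicFixed.1 hg
  have hstep : ∀ r ∈ Finset.Icc 1 n,
      ((frobeniusFixed L p r).filter fun x => orbitPoly p r x ∣ g).card =
      ∑ x ∈ g.roots.toFinset, if x ∈ frobeniusFixed L p r ∧ orbitPoly p r x ∣ g then 1 else 0 := by
    intro r hr
    rw [← Finset.sum_filter, ← Finset.card_eq_sum_ones]
    congr 1
    ext x
    simp only [Finset.mem_filter, Multiset.mem_toFinset, mem_roots h1.ne_zero]
    refine ⟨fun h => ⟨?_, h⟩, fun h => h.2⟩
    rw [← dvd_iff_isRoot]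
    refine dvd_trans ?_ h.2
    rw [orbitPoly]
    have := Finset.dvd_prod_of_mem (fun i => X - C (x ^ p ^ i))
      (Finset.mem_range.2 (Finset.mem_Icc.1 hr).1)
    simpa using this
  rw [Finset.sum_congr rfl hstep, Finset.sum_comm]
  simp_rw [← Finset.sum_filter, ← Finset.card_eq_sum_ones]
  have : ∀ x ∈ g.roots.toFinset,
      ((Finset.Icc 1 n).filter fun r => x ∈ frobeniusFixed L p r ∧ orbitPoly p r x ∣ g).card =
        g.roots.count x := by
    intro x hx
    rw [count_roots]
    exact card_orbitPoly_dvd h3 h1.ne_zero h2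
      ((mem_roots h1.ne_zero).1 (Multiset.mem_toFinset.1 hx))
  rw [Finset.sum_congr rfl this, Multiset.toFinset_sum_count_eq,
    splits_iff_card_roots.1 (IsAlgClosed.splits _), h2]

theorem orbitPoly_mul_mem {n r : ℕ} (hr : 1 ≤ r) (hrn : r ≤ n) {x : L}
    (hx : x ∈ frobeniusFixed L p r) {h : L[X]} :
    orbitPoly p r x * h ∈ monicFixed L p n ↔ h ∈ monicFixed L p (n - r) := by
  have hχ := orbitPoly_monic p r x
  rw [mem_monicFixed, mem_monicFixed, Polynomial.map_mul,
    map_frobenius_orbitPoly ((mem_frobeniusFixed hr).1 hx)]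
  have hmon : (orbitPoly p r x * h).Monic ↔ h.Monic := ⟨hχ.of_mul_monic_left, hχ.mul⟩
  rw [hmon]
  refine and_congr_right fun hh => ?_
  rw [hχ.natDegree_mul hh, natDegree_orbitPoly, mul_right_inj' hχ.ne_zero]
  exact and_congr_left fun _ => by omega

theorem mul_lCoeff_eq_sum (Φ : AddChar L ℂ) (f : (ZMod p)[X]) (n : ℕ) :
    n * lCoeff Φ f n = ∑ r ∈ Finset.Icc 1 n, expSum Φ f r * lCoeff Φ f (n - r) := by
  classical
  have hprod : ∀ r ∈ Finset.Icc 1 n, expSum Φ f r * lCoeff Φ f (n - r) =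
      ∑ g ∈ monicFixed L p n,
        ((frobeniusFixed L p r).filter fun x => orbitPoly p r x ∣ g).card * rootChar Φ f g := by
    intro r hr
    obtain ⟨hr1, hrn⟩ := Finset.mem_Icc.1 hr
    rw [expSum, Finset.sum_mul]
    have hx : ∀ x ∈ frobeniusFixed L p r,
        Φ (∑ i ∈ Finset.range r, aeval (x ^ p ^ i) f) * lCoeff Φ f (n - r) =
        ∑ g ∈ monicFixed L p n, if orbitPoly p r x ∣ g then rootChar Φ f g else 0 := by
      intro x hx
      have hχ := orbitPoly_monic p r x
      have hroot : Φ (∑ i ∈ Finset.range r, aeval (x ^ p ^ i) f) =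
          rootChar Φ f (orbitPoly p r x) := by
        have hr : (orbitPoly p r x).roots = (Finset.range r).val.map fun i => x ^ p ^ i := by
          rw [← roots_multiset_prod_X_sub_C ((Finset.range r).val.map fun i => x ^ p ^ i),
            Multiset.map_map]
          rfl
        rw [rootChar, hr, Multiset.map_map]
        rfl
      rw [← Finset.sum_filter, hroot, lCoeff, Finset.mul_sum]
      refine Finset.sum_nbij (fun h => orbitPoly p r x * h) ?_ ?_ ?_ ?_
      · intro h hh
        exact Finset.mem_filter.2 ⟨(orbitPoly_mul_mem hr1 hrn hx).2 hh, dvd_mul_right _ _⟩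
      · intro h _ h' _ heq
        exact mul_left_cancel₀ hχ.ne_zero heq
      · intro g hg
        obtain ⟨hg, h, rfl⟩ := Finset.mem_filter.1 (Finset.mem_coe.1 hg)
        exact ⟨h, (orbitPoly_mul_mem hr1 hrn hx).1 hg, rfl⟩
      · intro h hh
        exact (rootChar_mul Φ f hχ (mem_monicFixed.1 hh).1).symm
    rw [Finset.sum_congr rfl hx, Finset.sum_comm]
    refine Finset.sum_congr rfl fun g _ => ?_
    rw [← Finset.sum_filter, Finset.sum_const, nsmul_eq_mul]
  rw [Finset.sum_congr rfl hprod, Finset.sum_comm, lCoeff, Finset.mul_sum]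
  refine Finset.sum_congr rfl fun g hg => ?_
  rw [← Finset.sum_mul, ← Nat.cast_sum, sum_card_orbitPoly_dvd hg]

end LFunctionRecurrence

section Weil

open Polynomial

/-- Two sequences obeying Newton's recurrence with the same coefficients agree up to sign. -/
theorem sum_pow_eq_neg_of_recurrence {a S : ℕ → ℂ} {k : ℕ} (ha0 : a 0 = 1)
    (ha : ∀ n, k ≤ n → a n = 0)
    (hS : ∀ n : ℕ, n * a n = ∑ r ∈ Finset.Icc 1 n, S r * a (n - r)) (hk : 1 ≤ k) :
    ∃ s : Multiset ℂ, s.card = k - 1 ∧ ∀ r, 1 ≤ r → S r = -(s.map (· ^ r)).sum := by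
  set M : ℂ[X] := ∑ n ∈ Finset.range k, C (a n) * X ^ (k - 1 - n) with hM
  have hcoeff : ∀ j < k, M.coeff (k - 1 - j) = a j := by
    intro j hj
    rw [hM, finsetSum_coeff, Finset.sum_eq_single_of_mem j (Finset.mem_range.2 hj)]
    · simp
    · intro b hb hbj
      have := Finset.mem_range.1 hb
      rw [coeff_C_mul, coeff_X_pow, if_neg (by omega), mul_zero]
  have hdeg : M.natDegree ≤ k - 1 := by
    refine natDegree_sum_le_of_forall_le _ _ fun n hn => ?_
    exact (natDegree_C_mul_X_pow_le _ _).trans (by omega)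
  have htop : M.coeff (k - 1) = 1 := by
    have := hcoeff 0 hk
    rwa [Nat.sub_zero, ha0] at this
  have hnat : M.natDegree = k - 1 :=
    natDegree_eq_of_le_of_coeff_ne_zero hdeg (by rw [htop]; exact one_ne_zero)
  have hmonic : M.Monic := by rw [Monic, leadingCoeff, hnat, htop]
  have hcard : M.roots.card = k - 1 := by
    rw [splits_iff_card_roots.1 (IsAlgClosed.splits M), hnat]
  have hesymm : ∀ j, M.roots.esymm j = (-1) ^ j * a j := by
    intro j
    rcases lt_or_ge j k with hj | hj
    · rw [esymm_roots_of_monic hmonic (by omega), hnat, hcoeff j hj]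
    · rw [ha j hj, mul_zero, Multiset.esymm, Multiset.powersetCard_eq_empty _ (by omega)]
      simp
  refine ⟨M.roots, hcard, fun r => ?_⟩
  induction r using Nat.strong_induction_on with
  | _ r ih =>
    intro hr
    have h1 := Multiset.mul_esymm_eq_sum_range M.roots r
    have h2 := hS r
    obtain ⟨m, rfl⟩ : ∃ m, r = m + 1 := ⟨r - 1, by omega⟩
    have hpr : ∀ q : ℕ, (∑ r ∈ Finset.Icc 1 q, S r * a (q - r)) =
        ∑ i ∈ Finset.range q, a i * S (q - i) := by
      intro q
      refine Finset.sum_nbij' (fun r => q - r) (fun i => q - i) ?_ ?_ ?_ ?_ ?_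
      all_goals simp only [Finset.mem_Icc, Finset.mem_range]
      · intro i hi; omega
      · intro i hi; omega
      · intro i hi; omega
      · intro i hi; omega
      · intro i hi
        rw [mul_comm, Nat.sub_sub_self hi.2]
    rw [hpr, Finset.sum_range_succ'] at h2
    simp only [hesymm] at h1
    rw [Finset.sum_range_succ'] at h1
    have h3 : ∑ i ∈ Finset.range m, a (i + 1) * S (m + 1 - (i + 1)) =
        - ∑ i ∈ Finset.range m, a (i + 1) * (M.roots.map (· ^ (m + 1 - (i + 1)))).sum := by
      rw [← Finset.sum_neg_distrib]
      refine Finset.sum_congr rfl fun i hi => ?_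
      have := Finset.mem_range.1 hi
      rw [ih _ (by omega) (by omega), mul_neg]
    have hs : ∀ i : ℕ, ((-1 : ℂ) ^ i * (-1) ^ i) = 1 := fun i => by
      rw [← mul_pow]; simp
    simp only [← mul_assoc, hs, one_mul, pow_zero, Nat.sub_zero, ha0] at h1 h2
    have h4 : ((-1 : ℂ)) ^ (m + 1) * ((m + 1 : ℕ) * a (m + 1)) = -(-1) ^ (m + 1) *
      (∑ i ∈ Finset.range m, a (i + 1) * (M.roots.map (· ^ (m + 1 - (i + 1)))).sum +
        (M.roots.map (· ^ (m + 1))).sum) := by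
      rw [← mul_assoc, mul_comm ((-1 : ℂ) ^ (m + 1)), h1]; ring
    rw [neg_mul, ← mul_neg] at h4
    have h5 := mul_left_cancel₀ (pow_ne_zero _ (by norm_num)) h4
    rw [h2, h3] at h5
    linear_combination h5

variable {p : ℕ} [hp : Fact p.Prime]

/-- Weil's bound for additive character sums of polynomials over a prime field. -/
theorem norm_sum_addChar_eval_le {χ : AddChar (ZMod p) ℂ} (hχ : χ ≠ 1) {f : (ZMod p)[X]}
    (hf : ¬ p ∣ f.natDegree) :
    ‖∑ u : ZMod p, χ (f.eval u)‖ ≤ (f.natDegree - 1 : ℕ) * √p := by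
  classical
  let L := AlgebraicClosure (ZMod p)
  have : CharP L p := charP_of_injective_algebraMap (algebraMap (ZMod p) L).injective p
  obtain ⟨π, hπ⟩ := (Algebra.linearMap (ZMod p) L).exists_leftInverse_of_injective
    (LinearMap.ker_eq_bot.2 (algebraMap (ZMod p) L).injective)
  let Φ : AddChar L ℂ := χ.compAddMonoidHom π.toAddMonoidHom
  have hΦ : ∀ a, Φ (algebraMap (ZMod p) L a) = χ a := fun a =>
    congrArg χ (LinearMap.congr_fun hπ a)
  have hdeg : 1 ≤ f.natDegree := Nat.pos_of_ne_zero fun h => hf (h ▸ dvd_zero p)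
  obtain ⟨s, hs, hS⟩ := sum_pow_eq_neg_of_recurrence (lCoeff_zero Φ f)
    (fun n hn => lCoeff_eq_zero hχ hΦ hf hn) (mul_lCoeff_eq_sum Φ f) hdeg
  have hp0 : (0 : ℝ) ≤ p := p.cast_nonneg
  have hroot : ∀ z ∈ s, ‖z‖ ≤ √p := by
    intro z hz
    refine Real.le_sqrt_of_sq_le ?_
    rw [← norm_pow]
    refine norm_le_of_norm_sum_pow_le (s := s.map (· ^ 2)) (C := p * (3 * f.natDegree + 1)) hp0
      ?_ (Multiset.mem_map_of_mem _ hz)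
    intro r hr
    have h := norm_expSum_le hχ hΦ hf (r - 1)
    rw [Nat.sub_add_cancel hr, hS _ (by omega), norm_neg] at h
    simpa only [Multiset.map_map, Function.comp_def, ← pow_mul] using h
  have h1 : ∑ u : ZMod p, χ (f.eval u) = expSum Φ f 1 := by
    rw [expSum, ← image_algebraMap_eq_frobeniusFixed_one,
      Finset.sum_image fun _ _ _ _ h => (algebraMap (ZMod p) L).injective h]
    refine Finset.sum_congr rfl fun u _ => ?_
    rw [Finset.sum_range_one, pow_zero, pow_one, aeval_algebraMap_apply, coe_aeval_eq_eval, hΦ]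
  rw [h1, hS 1 le_rfl, norm_neg, ← hs]
  simp only [pow_one, Multiset.map_id']
  calc ‖s.sum‖ ≤ (s.map fun z => ‖z‖).sum := norm_multiset_sum_le s
    _ ≤ (s.map fun _ => √p).sum := Multiset.sum_map_le_sum_map _ _ hroot
    _ = s.card * √p := by simp

end Weil

section Completion

/-- The point of the unit circle with argument `2 π θ`. -/
noncomputable def circleExp (θ : ℝ) : ℂ :=
  Complex.exp (Complex.I * ((2 * Real.pi * θ : ℝ) : ℂ))

theorem norm_circleExp (θ : ℝ) : ‖circleExp θ‖ = 1 :=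
  Complex.norm_exp_I_mul_ofReal _

theorem circleExp_add (θ η : ℝ) : circleExp (θ + η) = circleExp θ * circleExp η := by
  rw [circleExp, circleExp, circleExp, ← Complex.exp_add]
  push_cast
  ring_nf

theorem stdAddChar_intCast (N : ℕ) [NeZero N] (z : ℤ) :
    ZMod.stdAddChar (z : ZMod N) = circleExp (z / N) := by
  rw [ZMod.stdAddChar_coe, circleExp]
  push_cast
  ring_nf

theorem norm_geom_sum_circleExp_le_card (θ : ℝ) (n : ℕ) :
    ‖∑ u ∈ Finset.range n, circleExp θ ^ u‖ ≤ n := by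
  refine (norm_sum_le _ _).trans ?_
  simp [norm_circleExp]

theorem norm_geom_sum_circleExp_le {s : ℝ} (h0 : 0 < s) (h1 : s < 1) (n : ℕ) :
    ‖∑ u ∈ Finset.range n, circleExp s ^ u‖ ≤ 1 / (2 * s) + 1 / (2 * (1 - s)) := by
  have hsin : 2 * min s (1 - s) ≤ Real.sin (Real.pi * s) := by
    have hπ := Real.pi_pos
    rcases le_total s (1 / 2) with h | h
    · have := Real.mul_le_sin (x := Real.pi * s) (by positivity) (by nlinarith)
      have h2 : 2 / Real.pi * (Real.pi * s) = 2 * s := by field_simp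
      rw [h2] at this
      exact (mul_le_mul_of_nonneg_left (min_le_left _ _) zero_le_two).trans this
    · have := Real.mul_le_sin (x := Real.pi * (1 - s)) (by nlinarith) (by nlinarith)
      have h2 : 2 / Real.pi * (Real.pi * (1 - s)) = 2 * (1 - s) := by field_simp
      rw [h2, show Real.pi * (1 - s) = Real.pi - Real.pi * s by ring, Real.sin_pi_sub] at this
      exact (mul_le_mul_of_nonneg_left (min_le_right _ _) zero_le_two).trans this
  have hmin : 0 < min s (1 - s) := lt_min h0 (by linarith)
  have hnorm : 4 * min s (1 - s) ≤ ‖circleExp s - 1‖ := by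
    rw [circleExp, Complex.norm_exp_I_mul_ofReal_sub_one, mul_assoc 2 Real.pi s,
      mul_div_cancel_left₀ _ two_ne_zero]
    exact (by linarith : _ ≤ 2 * Real.sin (Real.pi * s)).trans (le_abs_self _)
  have hgeom := congrArg norm (mul_geom_sum (circleExp s) n)
  have htwo : ‖circleExp s ^ n - 1‖ ≤ 2 := by
    refine (norm_sub_le _ _).trans ?_
    rw [norm_pow, norm_circleExp, one_pow, norm_one]
    norm_num
  rw [norm_mul] at hgeom
  have hmul : 4 * min s (1 - s) * ‖∑ u ∈ Finset.range n, circleExp s ^ u‖ ≤ 2 := by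
    refine le_trans ?_ htwo
    rw [← hgeom]
    gcongr
  have hle : ‖∑ u ∈ Finset.range n, circleExp s ^ u‖ ≤ 1 / (2 * min s (1 - s)) := by
    rw [le_div_iff₀ (by positivity)]
    linarith
  refine hle.trans ?_
  have h1' : 0 < 1 - s := by linarith
  rcases min_choice s (1 - s) with h | h <;> rw [h]
  · exact le_add_of_nonneg_right (by positivity)
  · exact le_add_of_nonneg_left (by positivity)

theorem sum_norm_geom_sum_circleExp_le {n q : ℕ} (hn : n ≤ q + 2) {t : ℝ} (ht0 : 0 ≤ t)
    (ht1 : t < 1) :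
    ∑ j ∈ Finset.range (q + 2), ‖∑ u ∈ Finset.range n, circleExp ((t + j) / (q + 2 : ℕ)) ^ u‖ ≤
      (q + 2 : ℕ) * (3 + Real.log (q + 2 : ℕ)) := by
  have hN : (0 : ℝ) < (q + 2 : ℕ) := by positivity
  have hmid : ∀ i ∈ Finset.range q,
      ‖∑ u ∈ Finset.range n, circleExp ((t + (i + 1 : ℕ)) / (q + 2 : ℕ)) ^ u‖ ≤
        (q + 2 : ℕ) / 2 * (((i + 1 : ℕ) : ℝ)⁻¹ + ((q - 1 - i + 1 : ℕ) : ℝ)⁻¹) := by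
    intro i hi
    have hi' := Finset.mem_range.1 hi
    have hq : ((q - 1 - i + 1 : ℕ) : ℝ) = q - i := by
      rw [show q - 1 - i + 1 = q - i by omega, Nat.cast_sub hi'.le]
    have hqi : (i : ℝ) + 1 ≤ q := by exact_mod_cast hi'
    have hi0 : (0 : ℝ) ≤ i := i.cast_nonneg
    have hs1 : 1 - (t + (i + 1 : ℕ)) / (q + 2 : ℕ) = (q + 1 - i - t) / (q + 2 : ℕ) := by
      field_simp
      push_cast
      ring
    have hs0 : 0 < (t + (i + 1 : ℕ)) / (q + 2 : ℕ) := by positivity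
    have hs2 : 0 < 1 - (t + (i + 1 : ℕ)) / (q + 2 : ℕ) := by
      rw [hs1]
      exact div_pos (by linarith) hN
    refine (norm_geom_sum_circleExp_le hs0 (by linarith) n).trans ?_
    rw [hs1, hq, mul_add]
    refine add_le_add ?_ ?_
    · rw [show 1 / (2 * ((t + (i + 1 : ℕ)) / (q + 2 : ℕ))) =
        ((q + 2 : ℕ) : ℝ) / 2 * (t + (i + 1 : ℕ))⁻¹ by field_simp]
      gcongr
      linarith
    · rw [show 1 / (2 * ((q + 1 - i - t) / (q + 2 : ℕ))) =
        ((q + 2 : ℕ) : ℝ) / 2 * (q + 1 - i - t)⁻¹ by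
          have : q + 1 - i - t ≠ 0 := by linarith
          field_simp]
      exact mul_le_mul_of_nonneg_left (inv_anti₀ (by linarith) (by linarith)) (by positivity)
  have hharm : ∑ i ∈ Finset.range q, ((i + 1 : ℕ) : ℝ)⁻¹ ≤ 1 + Real.log (q + 2 : ℕ) := by
    have h := harmonic_le_one_add_log q
    rw [harmonic] at h
    push_cast at h ⊢
    refine h.trans ?_
    rcases Nat.eq_zero_or_pos q with rfl | hq
    · simpa using Real.log_nonneg (by norm_num)
    · gcongr
      linarith
  have hrefl := Finset.sum_range_reflect (fun i => ((i + 1 : ℕ) : ℝ)⁻¹) q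
  rw [Finset.sum_range_succ, Finset.sum_range_succ']
  have hsum := Finset.sum_le_sum hmid
  rw [← Finset.mul_sum, Finset.sum_add_distrib, hrefl] at hsum
  have hn' : (n : ℝ) ≤ (q + 2 : ℕ) := by exact_mod_cast hn
  have e1 := norm_geom_sum_circleExp_le_card ((t + (0 : ℕ)) / (q + 2 : ℕ)) n
  have e2 := norm_geom_sum_circleExp_le_card ((t + (q + 1 : ℕ)) / (q + 2 : ℕ)) n
  have e3 := mul_le_mul_of_nonneg_left hharm hN.le
  linarith

theorem sum_norm_geom_sum_stdAddChar_le {p : ℕ} [hp : Fact p.Prime] {n : ℕ} (hn : n ≤ p)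
    (α : ℝ) :
    ∑ c : ZMod p, ‖∑ u ∈ Finset.range n, (ZMod.stdAddChar (-c) * circleExp α) ^ u‖ ≤
      p * (3 + Real.log p) := by
  have hp0 : (p : ℝ) ≠ 0 := by exact_mod_cast hp.out.ne_zero
  obtain ⟨q, hq⟩ : ∃ q, p = q + 2 := ⟨p - 2, by have := hp.out.two_le; omega⟩
  have key : ∑ c : ZMod p, ‖∑ u ∈ Finset.range n, (ZMod.stdAddChar (-c) * circleExp α) ^ u‖ =
      ∑ j ∈ Finset.range p,
        ‖∑ u ∈ Finset.range n, circleExp ((Int.fract (α * p) + j) / p) ^ u‖ := by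
    symm
    refine Finset.sum_nbij (fun j => ((⌊α * p⌋ - j : ℤ) : ZMod p)) (fun _ _ => Finset.mem_univ _)
      ?_ ?_ ?_
    · intro j hj j' hj' h
      have h' : (j : ZMod p) = j' := by
        push_cast at h
        exact sub_right_injective h
      have := (ZMod.natCast_eq_natCast_iff' _ _ _).1 h'
      rwa [Nat.mod_eq_of_lt (by simpa using hj), Nat.mod_eq_of_lt (by simpa using hj')] at this
    · intro c _
      refine ⟨((⌊α * p⌋ : ℤ) - c : ZMod p).val, by simpa using ZMod.val_lt _, ?_⟩
      simp
    · intro j _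
      rw [← Int.cast_neg, stdAddChar_intCast, ← circleExp_add]
      have : ((-(⌊α * p⌋ - j : ℤ) : ℤ) : ℝ) / p + α = (Int.fract (α * p) + j) / p := by
        rw [← Int.self_sub_floor]
        field_simp
        push_cast
        ring
      rw [this]
  rw [key]
  subst hq
  exact sum_norm_geom_sum_circleExp_le hn (Int.fract_nonneg _) (Int.fract_lt_one _)

/-- Completion of an incomplete exponential sum. -/
theorem norm_sum_range_mul_circleExp_le {p : ℕ} [hp : Fact p.Prime] {F : ZMod p → ℂ} {A : ℝ}
    (hA : ∀ c, ‖∑ x, F x * ZMod.stdAddChar (c * x)‖ ≤ A) {n : ℕ} (hn : n ≤ p) (α : ℝ) :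
    ‖∑ u ∈ Finset.range n, F ((u + 1 : ℕ) : ZMod p) * circleExp α ^ (u + 1)‖ ≤
      A * (3 + Real.log p) := by
  have hp0 : (0 : ℝ) < p := by exact_mod_cast hp.out.pos
  have hA0 : 0 ≤ A := (norm_nonneg _).trans (hA 0)
  have hinv : ∀ x, (p : ℂ) * F x =
      ∑ c, (∑ y, F y * ZMod.stdAddChar (c * y)) * ZMod.stdAddChar (-c * x) := by
    intro x
    simp_rw [Finset.sum_mul]
    rw [Finset.sum_comm]
    have : ∀ y, ∑ c, F y * ZMod.stdAddChar (c * y) * ZMod.stdAddChar (-c * x) =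
        F y * if y = x then (p : ℂ) else 0 := by
      intro y
      simp_rw [mul_assoc, ← AddChar.map_add_eq_mul]
      rw [← Finset.mul_sum]
      have h := AddChar.sum_mulShift (y - x) (ZMod.isPrimitive_stdAddChar p)
      rw [ZMod.card] at h
      congr 1
      simp only [sub_eq_zero] at h
      rw [show (if y = x then (p : ℂ) else 0) = ((if y = x then p else 0 : ℕ) : ℂ) by
        split_ifs <;> simp, ← h]
      refine Finset.sum_congr rfl fun c _ => ?_
      congr 1
      ring
    rw [Finset.sum_congr rfl fun y _ => this y]
    simp [mul_comm]
  have hexp : (p : ℂ) * ∑ u ∈ Finset.range n, F ((u + 1 : ℕ) : ZMod p) * circleExp α ^ (u + 1) =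
      ∑ c, (∑ y, F y * ZMod.stdAddChar (c * y)) * ((ZMod.stdAddChar (-c) * circleExp α) *
        ∑ u ∈ Finset.range n, (ZMod.stdAddChar (-c) * circleExp α) ^ u) := by
    simp_rw [Finset.mul_sum]
    rw [Finset.sum_comm]
    refine Finset.sum_congr rfl fun u _ => ?_
    rw [← mul_assoc, hinv, Finset.sum_mul]
    refine Finset.sum_congr rfl fun c _ => ?_
    have : ZMod.stdAddChar (-c * ((u + 1 : ℕ) : ZMod p)) = ZMod.stdAddChar (-c) ^ (u + 1) := by
      rw [← AddChar.map_nsmul_eq_pow, nsmul_eq_mul, mul_comm]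
    rw [this, ← pow_succ', mul_pow, mul_assoc]
  have hnorm := congrArg norm hexp
  rw [norm_mul, Complex.norm_natCast] at hnorm
  refine le_of_mul_le_mul_left ?_ hp0
  rw [hnorm]
  calc _ ≤ ∑ c : ZMod p, A *
        ‖∑ u ∈ Finset.range n, (ZMod.stdAddChar (-c) * circleExp α) ^ u‖ := by
        refine (norm_sum_le _ _).trans (Finset.sum_le_sum fun c _ => ?_)
        rw [norm_mul, norm_mul (_ * _), norm_mul (ZMod.stdAddChar _), AddChar.norm_apply,
          norm_circleExp, one_mul, one_mul]
        gcongr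
        exact hA c
    _ ≤ A * (p * (3 + Real.log p)) := by
        rw [← Finset.mul_sum]
        gcongr
        exact sum_norm_geom_sum_stdAddChar_le hn α
    _ = p * (A * (3 + Real.log p)) := by ring

end Completion

section Inner

open Polynomial

theorem norm_sum_stdAddChar_eval_mul_circleExp_le {p : ℕ} [hp : Fact p.Prime] {h : (ZMod p)[X]}
    (h2 : 2 ≤ h.natDegree) (hlt : h.natDegree < p) {n : ℕ} (hn : n ≤ p) (α : ℝ) :
    ‖∑ u ∈ Finset.range n,
        ZMod.stdAddChar (h.eval ((u + 1 : ℕ) : ZMod p)) * circleExp α ^ (u + 1)‖ ≤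
      (h.natDegree - 1 : ℕ) * √p * (3 + Real.log p) := by
  have hχ : (ZMod.stdAddChar : AddChar (ZMod p) ℂ) ≠ 1 := by
    intro h1
    have : (1 : ZMod p) = 0 := ZMod.injective_stdAddChar (N := p) (by rw [h1]; simp)
    exact one_ne_zero this
  refine norm_sum_range_mul_circleExp_le (F := fun x => ZMod.stdAddChar (h.eval x))
    (fun c => ?_) hn α
  have hdeg : (h + C c * X).natDegree = h.natDegree := by
    refine natDegree_add_eq_left_of_natDegree_lt ((natDegree_C_mul_le c X).trans_lt ?_)
    rw [natDegree_X]
    exact h2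
  have := norm_sum_addChar_eval_le hχ (f := h + C c * X)
    (by rw [hdeg]; exact Nat.not_dvd_of_pos_of_lt (by omega) hlt)
  rw [hdeg] at this
  simpa [AddChar.map_add_eq_mul] using this

theorem eInt_eq_circleExp (m : ℕ) (z : ℤ) : eInt m z = circleExp (z / m) := by
  rw [eInt, circleExp]
  push_cast
  ring_nf

theorem norm_eInt (m : ℕ) (z : ℤ) : ‖eInt m z‖ = 1 := by
  rw [eInt_eq_circleExp, norm_circleExp]

theorem eInt_add (m : ℕ) (z w : ℤ) : eInt m (z + w) = eInt m z * eInt m w := by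
  rw [eInt_eq_circleExp, eInt_eq_circleExp, eInt_eq_circleExp, ← circleExp_add]
  push_cast
  rw [add_div]

theorem conj_eInt (m : ℕ) (z : ℤ) : (starRingEnd ℂ) (eInt m z) = eInt m (-z) := by
  rw [eInt, eInt, ← Complex.exp_conj]
  simp [Complex.conj_ofNat]

theorem eInt_sub (m : ℕ) (z w : ℤ) :
    eInt m (z - w) = (starRingEnd ℂ) (eInt m w) * eInt m z := by
  rw [conj_eInt, ← eInt_add, sub_eq_neg_add]

theorem eInt_mul_natCast (m : ℕ) (z : ℤ) (u : ℕ) : eInt m (z * u) = eInt m z ^ u := by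
  rw [eInt, eInt, ← Complex.exp_nat_mul]
  push_cast
  ring_nf

theorem eInt_eq_stdAddChar (m : ℕ) [NeZero m] (z : ℤ) :
    eInt m z = ZMod.stdAddChar (z : ZMod m) := by
  rw [eInt_eq_circleExp, stdAddChar_intCast]

theorem sum_eInt_mul (n : ℕ) [NeZero n] (m : ℤ) :
    ∑ u : Fin n, eInt n (m * ((u : ℕ) + 1)) = if (n : ℤ) ∣ m then (n : ℂ) else 0 := by
  have hu : ∀ u : Fin n, eInt n (m * ((u : ℕ) + 1)) = eInt n m * eInt n m ^ (u : ℕ) := by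
    intro u
    rw [mul_add, mul_one, eInt_add, eInt_mul_natCast, mul_comm]
  rw [Finset.sum_congr rfl fun u _ => hu u, ← Finset.mul_sum,
    Fin.sum_univ_eq_sum_range (fun u => eInt n m ^ u)]
  have hone : eInt n m = 1 ↔ (n : ℤ) ∣ m := by
    rw [← ZMod.intCast_zmod_eq_zero_iff_dvd, eInt_eq_stdAddChar,
      ← ZMod.injective_stdAddChar.eq_iff (a := (m : ZMod n)), AddChar.map_zero_eq_one]
  split_ifs with h
  · rw [hone.2 h]; simp
  · have hne := mt hone.1 h
    have hpow : eInt n (m * n) = 1 := by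
      rw [eInt_eq_stdAddChar]
      simp
    rw [geom_sum_eq hne, ← eInt_mul_natCast, hpow, sub_self, zero_div, mul_zero]

variable {d n p : ℕ} {ψ : (Fin d → Fin n) → ℕ → EuclideanSpace ℂ (Fin n)}

theorem inner_eq_sum_eInt
    (hψ : ∀ a i u, ψ a i u =
      (1 / Real.sqrt n : ℝ) *
        eInt p (∑ ν : Fin d, ((a ν : ℕ) : ℤ) * ((u : ℕ) + 1) ^ ((ν : ℕ) + 2)) *
        eInt n ((i : ℤ) * ((u : ℕ) + 1))) (a b : Fin d → Fin n) (i j : ℕ) :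
    ⟪ψ b j, ψ a i⟫ = (n : ℂ)⁻¹ * ∑ u : Fin n,
      eInt p (∑ ν : Fin d, (((a ν : ℕ) : ℤ) - (b ν : ℕ)) * ((u : ℕ) + 1) ^ ((ν : ℕ) + 2)) *
        eInt n (((i : ℤ) - j) * ((u : ℕ) + 1)) := by
  rw [PiLp.inner_apply, Finset.mul_sum]
  refine Finset.sum_congr rfl fun u _ => ?_
  have hn : ((1 / √n : ℝ) : ℂ) * ((1 / √n : ℝ) : ℂ) = (n : ℂ)⁻¹ := by
    rw [← Complex.ofReal_mul, div_mul_div_comm, one_mul, Real.mul_self_sqrt n.cast_nonneg]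
    simp
  simp_rw [sub_mul, Finset.sum_sub_distrib]
  rw [eInt_sub, eInt_sub, RCLike.inner_apply, hψ, hψ, ← hn, map_mul, map_mul, Complex.conj_ofReal]
  ring

theorem norm_inner_le_one (hn : 0 < n)
    (hψ : ∀ a i u, ψ a i u =
      (1 / Real.sqrt n : ℝ) *
        eInt p (∑ ν : Fin d, ((a ν : ℕ) : ℤ) * ((u : ℕ) + 1) ^ ((ν : ℕ) + 2)) *
        eInt n ((i : ℤ) * ((u : ℕ) + 1))) (a b : Fin d → Fin n) (i j : ℕ) :
    ‖⟪ψ b j, ψ a i⟫‖ ≤ 1 := by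
  have hn' : (0 : ℝ) < n := by exact_mod_cast hn
  rw [inner_eq_sum_eInt hψ, norm_mul, norm_inv, Complex.norm_natCast, inv_mul_le_iff₀ hn', mul_one]
  refine (norm_sum_le _ _).trans ?_
  simp [norm_eInt]

theorem norm_inner_le_of_lt [hp : Fact p.Prime] (hn : n ≤ p) (hdp : d + 1 < p)
    (hψ : ∀ a i u, ψ a i u =
      (1 / Real.sqrt n : ℝ) *
        eInt p (∑ ν : Fin d, ((a ν : ℕ) : ℤ) * ((u : ℕ) + 1) ^ ((ν : ℕ) + 2)) *
        eInt n ((i : ℤ) * ((u : ℕ) + 1))) {a b : Fin d → Fin n} (hab : a ≠ b) (i j : ℕ) :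
    ‖⟪ψ b j, ψ a i⟫‖ ≤ (n : ℝ)⁻¹ * (d * √p * (3 + Real.log p)) := by
  set h : (ZMod p)[X] :=
    ∑ ν : Fin d, C (((a ν : ℕ) : ZMod p) - ((b ν : ℕ) : ZMod p)) * X ^ ((ν : ℕ) + 2) with hh
  have hcoeff : ∀ ν : Fin d, h.coeff ((ν : ℕ) + 2) =
      ((a ν : ℕ) : ZMod p) - ((b ν : ℕ) : ZMod p) := by
    intro ν
    rw [hh, finsetSum_coeff, Finset.sum_eq_single_of_mem ν (Finset.mem_univ _)]
    · rw [coeff_C_mul, coeff_X_pow, if_pos rfl, mul_one]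
    · intro μ _ hμ
      rw [coeff_C_mul, coeff_X_pow, if_neg, mul_zero]
      intro heq
      exact hμ (Fin.ext (by omega))
  obtain ⟨ν, hν⟩ := Function.ne_iff.1 hab
  have hne : h.coeff ((ν : ℕ) + 2) ≠ 0 := by
    rw [hcoeff, sub_ne_zero]
    intro heq
    have := (ZMod.natCast_eq_natCast_iff' _ _ _).1 heq
    rw [Nat.mod_eq_of_lt ((a ν).2.trans_le hn), Nat.mod_eq_of_lt ((b ν).2.trans_le hn)] at this
    exact hν (Fin.ext this)
  have h2 : 2 ≤ h.natDegree := le_trans (by omega) (le_natDegree_of_ne_zero hne)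
  have hdeg : h.natDegree ≤ d + 1 := by
    refine natDegree_sum_le_of_forall_le _ _ fun μ _ => ?_
    exact (natDegree_C_mul_X_pow_le _ _).trans (by omega)
  have hsum : ∑ u : Fin n,
      eInt p (∑ ν : Fin d, (((a ν : ℕ) : ℤ) - (b ν : ℕ)) * ((u : ℕ) + 1) ^ ((ν : ℕ) + 2)) *
        eInt n (((i : ℤ) - j) * ((u : ℕ) + 1)) =
      ∑ u ∈ Finset.range n, ZMod.stdAddChar (h.eval ((u + 1 : ℕ) : ZMod p)) *
        circleExp ((((i : ℤ) - j : ℤ) : ℝ) / n) ^ (u + 1) := by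
    rw [← Fin.sum_univ_eq_sum_range]
    refine Finset.sum_congr rfl fun u _ => ?_
    rw [← eInt_eq_circleExp, ← eInt_mul_natCast, eInt_eq_stdAddChar, hh, eval_finsetSum]
    push_cast
    simp only [eval_mul, eval_C, eval_pow, eval_X]
  have hlog : 0 ≤ Real.log p := Real.log_natCast_nonneg p
  rw [inner_eq_sum_eInt hψ, norm_mul, norm_inv, Complex.norm_natCast, hsum]
  refine mul_le_mul_of_nonneg_left ?_ (by positivity)
  refine (norm_sum_stdAddChar_eval_mul_circleExp_le h2 (hdeg.trans_lt hdp) hn _).trans ?_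
  gcongr
  omega

theorem sqrt_mul_log_le {n p : ℕ} (hn : 1 ≤ n) (hp0 : 0 < p) (hp : p ≤ 2 * n) :
    (n : ℝ)⁻¹ * (√p * (3 + Real.log p)) ≤ 20 * (n : ℝ) ^ (-(1 / 3 : ℝ)) := by
  have hn' : (1 : ℝ) ≤ n := by exact_mod_cast hn
  have hn0 : (0 : ℝ) < n := by linarith
  have hp' : (p : ℝ) ≤ 2 * n := by exact_mod_cast hp
  have hp1 : (0 : ℝ) < p := by exact_mod_cast hp0
  have h1 : √p ≤ 2 * (n : ℝ) ^ (1 / 2 : ℝ) := by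
    rw [← Real.sqrt_eq_rpow, Real.sqrt_le_left (by positivity), mul_pow, Real.sq_sqrt hn0.le]
    linarith
  have h2 : 3 + Real.log p ≤ 10 * (n : ℝ) ^ (1 / 6 : ℝ) := by
    have e1 : Real.log p ≤ Real.log 2 + Real.log n := by
      rw [← Real.log_mul two_ne_zero hn0.ne']
      exact Real.log_le_log hp1 hp'
    have e2 := Real.log_le_rpow_div hn0.le (ε := 1 / 6) (by norm_num)
    have e3 := Real.log_two_lt_d9
    have e4 := Real.one_le_rpow hn' (z := 1 / 6) (by norm_num)
    linarith
  have hlog : 0 ≤ Real.log p := Real.log_natCast_nonneg p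
  calc (n : ℝ)⁻¹ * (√p * (3 + Real.log p))
      ≤ (n : ℝ)⁻¹ * (2 * (n : ℝ) ^ (1 / 2 : ℝ) * (10 * (n : ℝ) ^ (1 / 6 : ℝ))) := by gcongr
    _ = 20 * ((n : ℝ) ^ (-1 : ℝ) * (n : ℝ) ^ (1 / 2 : ℝ) * (n : ℝ) ^ (1 / 6 : ℝ)) := by
        rw [Real.rpow_neg_one]; ring
    _ = 20 * (n : ℝ) ^ (-(1 / 3 : ℝ)) := by
        rw [← Real.rpow_add hn0, ← Real.rpow_add hn0]
        norm_num

theorem norm_inner_le_rpow (hn : 2 ≤ n) (hp : p.Prime) (hnp : n ≤ p)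
    (hmin : ∀ q : ℕ, q.Prime → n ≤ q → p ≤ q)
    (hψ : ∀ a i u, ψ a i u =
      (1 / Real.sqrt n : ℝ) *
        eInt p (∑ ν : Fin d, ((a ν : ℕ) : ℤ) * ((u : ℕ) + 1) ^ ((ν : ℕ) + 2)) *
        eInt n ((i : ℤ) * ((u : ℕ) + 1))) {a b : Fin d → Fin n} (hab : a ≠ b) (i j : ℕ) :
    ‖⟪ψ b j, ψ a i⟫‖ ≤ 20 * (d + 1) * (n : ℝ) ^ (-(1 / 3 : ℝ)) := by
  have : Fact p.Prime := ⟨hp⟩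
  have hn1 : (1 : ℝ) ≤ n := by exact_mod_cast (by omega : 1 ≤ n)
  rcases lt_or_ge (d + 1) p with hdp | hdp
  · obtain ⟨q, hq, hnq, hq2⟩ := Nat.exists_prime_lt_and_le_two_mul n (by omega)
    have hp2 := (hmin q hq hnq.le).trans hq2
    calc ‖⟪ψ b j, ψ a i⟫‖ ≤ (n : ℝ)⁻¹ * (d * √p * (3 + Real.log p)) :=
          norm_inner_le_of_lt hnp hdp hψ hab i j
      _ = d * ((n : ℝ)⁻¹ * (√p * (3 + Real.log p))) := by ring
      _ ≤ (d + 1) * (20 * (n : ℝ) ^ (-(1 / 3 : ℝ))) := by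
          refine mul_le_mul (by linarith) (sqrt_mul_log_le (by omega) hp.pos hp2) ?_
            (by positivity)
          have := Real.log_natCast_nonneg p
          positivity
      _ = 20 * (d + 1) * (n : ℝ) ^ (-(1 / 3 : ℝ)) := by ring
  · refine (norm_inner_le_one (by omega) hψ a b i j).trans ?_
    have hnd : (n : ℝ) ≤ d + 1 := by exact_mod_cast hnp.trans hdp
    have h1 : (n : ℝ)⁻¹ ≤ (n : ℝ) ^ (-(1 / 3 : ℝ)) := by
      rw [← Real.rpow_neg_one]
      exact Real.rpow_le_rpow_of_exponent_le hn1 (by norm_num)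
    calc (1 : ℝ) = n * (n : ℝ)⁻¹ := (mul_inv_cancel₀ (by linarith)).symm
      _ ≤ (20 * (d + 1)) * (n : ℝ) ^ (-(1 / 3 : ℝ)) := by
          gcongr
          linarith

theorem orthonormal_of_eq_eInt (hn : 2 ≤ n)
    (hψ : ∀ a i u, ψ a i u =
      (1 / Real.sqrt n : ℝ) *
        eInt p (∑ ν : Fin d, ((a ν : ℕ) : ℤ) * ((u : ℕ) + 1) ^ ((ν : ℕ) + 2)) *
        eInt n ((i : ℤ) * ((u : ℕ) + 1))) (a : Fin d → Fin n) :
    Orthonormal ℂ (fun i : Fin n => ψ a ((i : ℕ) + 1)) := by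
  have : NeZero n := ⟨by omega⟩
  rw [orthonormal_iff_ite]
  intro j i
  have h0 : eInt p 0 = 1 := by simp [eInt]
  rw [inner_eq_sum_eInt hψ]
  simp only [sub_self, zero_mul, Finset.sum_const_zero, h0, one_mul]
  rw [sum_eInt_mul]
  have hiff : (n : ℤ) ∣ (((i : ℕ) + 1 : ℕ) : ℤ) - (((j : ℕ) + 1 : ℕ) : ℤ) ↔ j = i := by
    rw [← Int.modEq_iff_dvd, Int.natCast_modEq_iff]
    refine ⟨fun h => Fin.ext ?_, fun h => by rw [h]⟩
    have := Nat.ModEq.add_right_cancel' 1 h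
    exact Nat.ModEq.eq_of_lt_of_lt this j.2 i.2
  simp only [hiff]
  split_ifs
  · exact inv_mul_cancel₀ (NeZero.ne _)
  · exact mul_zero _

end Inner

/-- Fix `d ≥ 1`.  For `n ≥ 2`, let `p` be the smallest prime
`p ≥ n`, and for a coefficient vector `a = (a_2, …, a_{d+1})` with
`0 ≤ a_ν ≤ n−1` (encoded as `a : Fin d → Fin n`, the coefficient of `X^{ν+2}`
being `a ν`) and `1 ≤ i ≤ n` let
`ψ_{a,i} = n^{-1/2}(e_p(Σ_ν a_ν u^{ν+2}) e_n(i u))_{u=1}^n ∈ ℂ^n`.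
Then: (i) each family `{ψ_{a,1}, …, ψ_{a,n}}` is an orthonormal basis of `ℂ^n`;
(ii) `|⟨e_u, ψ_{a,i}⟩| = n^{-1/2}`;
(iii) for a constant `C` depending only on `d`, distinct `a ≠ b` satisfy
`|⟨ψ_{b,j}, ψ_{a,i}⟩| ≤ C n^{-1/3}` if `d = 1` and `≤ C n^{-1/4}` if `d ≥ 2`. -/
theorem amub_arbitrary_dimensions
    (d : ℕ) (hd : 1 ≤ d) :
    ∃ C : ℝ, 0 < C ∧
      ∀ n : ℕ, 2 ≤ n →
      ∀ p : ℕ, p.Prime → n ≤ p → (∀ q : ℕ, q.Prime → n ≤ q → p ≤ q) →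
      ∀ ψ : (Fin d → Fin n) → ℕ → EuclideanSpace ℂ (Fin n),
        (∀ a i u, ψ a i u =
          (1 / Real.sqrt n : ℝ) *
            eInt p (∑ ν : Fin d, ((a ν : ℕ) : ℤ) * ((u : ℕ) + 1) ^ ((ν : ℕ) + 2)) *
            eInt n ((i : ℤ) * ((u : ℕ) + 1))) →
        ((∀ a, Orthonormal ℂ (fun i : Fin n => ψ a ((i : ℕ) + 1)) ∧
            Submodule.span ℂ (Set.range fun i : Fin n => ψ a ((i : ℕ) + 1)) = ⊤) ∧
         (∀ a i, 1 ≤ i → i ≤ n → ∀ u : Fin n,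
            ‖⟪(EuclideanSpace.single u 1 : EuclideanSpace ℂ (Fin n)), ψ a i⟫‖ =
              1 / Real.sqrt n) ∧
         (∀ a b, a ≠ b → ∀ i j, 1 ≤ i → i ≤ n → 1 ≤ j → j ≤ n →
            ‖⟪ψ b j, ψ a i⟫‖ ≤
              if d = 1 then C * (n : ℝ) ^ (-(1 / 3 : ℝ))
              else C * (n : ℝ) ^ (-(1 / 4 : ℝ)))) := by
  refine ⟨20 * (d + 1), by positivity, fun n hn p hp hnp hmin ψ hψ => ⟨fun a => ?_, ?_, ?_⟩⟩
  · have horth := orthonormal_of_eq_eInt hn hψ a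
    have : Nonempty (Fin n) := ⟨⟨0, by omega⟩⟩
    exact ⟨horth, horth.linearIndependent.span_eq_top_of_card_eq_finrank (by simp)⟩
  · intro a i _ _ u
    rw [EuclideanSpace.inner_single_left, hψ, map_one, one_mul, norm_mul, norm_mul, norm_eInt,
      norm_eInt, mul_one, mul_one, Complex.norm_real, Real.norm_of_nonneg (by positivity)]
  · intro a b hab i j _ _ _ _
    have h := norm_inner_le_rpow hn hp hnp hmin hψ hab i j
    split_ifs
    · exact h
    · refine h.trans (mul_le_mul_of_nonneg_left ?_ (by positivity))
      exact Real.rpow_le_rpow_of_exponent_le (by exact_mod_cast (by omega : 1 ≤ n)) (by norm_num)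
end

section
/- Let p be a prime and set n = p − 1 with n ≥ 2. Then there exist n + 1 orthonormal bases of ℂ^n such that any two vectors u, v belonging to distinct bases satisfy |⟨u, v⟩| ≤ (n+1)^{1/2} / n. In particular, since (n+1)^{1/2}/n = n^{-1/2} + O(n^{-1}), these bases form approximately mutually unbiased bases: n² + n unit vectors partitioned into n+1 orthonormal bases with |⟨u, v⟩|² ≤ (1 + o(1))/n for vectors from distinct bases. -/
open scoped ComplexInnerProductSpace

section GaussSumNorm

variable {F : Type*} [Field F] [Fintype F]

/-- The Gauss sum of nontrivial characters of a finite field has absolute value `√|F|`. -/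
lemma norm_gaussSum_eq_sqrt_card {χ : MulChar F ℂ} (hχ : χ ≠ 1) {ψ : AddChar F ℂ} (hψ : ψ ≠ 1) :
    ‖gaussSum χ ψ‖ = Real.sqrt (Fintype.card F) := by
  have h := gaussSum_mul_gaussSum_eq_card hχ (AddChar.IsPrimitive.of_ne_one hψ)
  rw [← star_gaussSum_eq, Complex.star_def, Complex.mul_conj'] at h
  rw [← Real.sqrt_sq (norm_nonneg (gaussSum χ ψ))]
  congr 1
  exact_mod_cast h

/-- Gauss sums over a finite field with nontrivial additive character are bounded by `√|F|`. -/
lemma norm_gaussSum_le_sqrt_card (χ : MulChar F ℂ) {ψ : AddChar F ℂ} (hψ : ψ ≠ 1) :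
    ‖gaussSum χ ψ‖ ≤ Real.sqrt (Fintype.card F) := by
  by_cases hχ : χ = 1
  · rw [hχ, gaussSum_one_left hψ, norm_neg, norm_one, Real.one_le_sqrt]
    exact_mod_cast Fintype.card_pos
  · exact (norm_gaussSum_eq_sqrt_card hχ hψ).le

lemma gaussSum_eq_sum_units [DecidableEq F] (χ : MulChar F ℂ) (ψ : AddChar F ℂ) :
    gaussSum χ ψ = ∑ x : Fˣ, χ x * ψ x := by
  refine (Finset.sum_of_injOn (fun x : Fˣ => (x : F)) Units.val_injective.injOn (by simp)
    (fun x _ hx => ?_) fun _ _ => rfl).symm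
  rw [χ.map_nonunit (fun ⟨u, hu⟩ => hx ⟨u, by simp, hu⟩), zero_mul]

end GaussSumNorm

section HybridCharacter

variable {F ι : Type*} [Field F] [Fintype F] [Fintype ι]

/-- The normalized product of a multiplicative and an additive character of `F`, as a vector
with coordinates indexed by the units of `F` through `e`. -/
noncomputable def hybridCharacterVector (e : ι ≃ Fˣ) (ψ : AddChar F ℂ) (χ : MulChar F ℂ) :
    EuclideanSpace ℂ ι :=
  WithLp.toLp 2 fun i => ((Real.sqrt (Fintype.card ι) : ℝ) : ℂ)⁻¹ * (χ (e i) * ψ (e i))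

lemma inner_hybridCharacterVector (e : ι ≃ Fˣ) (ψ ψ' : AddChar F ℂ) (χ χ' : MulChar F ℂ) :
    ⟪hybridCharacterVector e ψ χ, hybridCharacterVector e ψ' χ'⟫ =
      gaussSum (χ⁻¹ * χ') (ψ⁻¹ * ψ') / Fintype.card ι := by
  classical
  have hs : ((Real.sqrt (Fintype.card ι) : ℝ) : ℂ)⁻¹ * ((Real.sqrt (Fintype.card ι) : ℝ) : ℂ)⁻¹ =
      (Fintype.card ι : ℂ)⁻¹ := by
    rw [← mul_inv, ← Complex.ofReal_mul, Real.mul_self_sqrt (Nat.cast_nonneg _),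
      Complex.ofReal_natCast]
  rw [gaussSum_eq_sum_units, ← e.sum_comp, PiLp.inner_apply, Finset.sum_div]
  refine Finset.sum_congr rfl fun i _ => ?_
  have h1 : (starRingEnd ℂ) (χ (e i)) = χ⁻¹ (e i) := MulChar.star_apply' χ _
  have h2 : (starRingEnd ℂ) (ψ (e i)) = ψ⁻¹ (e i) := by
    rw [AddChar.inv_apply, AddChar.map_neg_eq_conj]
  simp only [hybridCharacterVector, RCLike.inner_apply, map_mul, map_inv₀, Complex.conj_ofReal,
    h1, h2, MulChar.mul_apply, AddChar.mul_apply, div_eq_mul_inv, ← hs]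
  ring

lemma orthonormal_hybridCharacterVector [Nonempty ι] (e : ι ≃ Fˣ) (ψ : AddChar F ℂ) :
    Orthonormal ℂ (hybridCharacterVector e ψ) := by
  classical
  rw [orthonormal_iff_ite]
  intro χ χ'
  rw [inner_hybridCharacterVector, inv_mul_cancel]
  split_ifs with h
  · rw [h, inv_mul_cancel, gaussSum_one_one, ← Nat.card_congr e, Nat.card_eq_fintype_card]
    exact div_self (by simp)
  · rw [gaussSum_one_right (by rwa [Ne, inv_mul_eq_one]), zero_div]

lemma norm_inner_hybridCharacterVector_le (e : ι ≃ Fˣ) {ψ ψ' : AddChar F ℂ} (h : ψ ≠ ψ')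
    (χ χ' : MulChar F ℂ) :
    ‖⟪hybridCharacterVector e ψ χ, hybridCharacterVector e ψ' χ'⟫‖ ≤
      Real.sqrt (Fintype.card F) / Fintype.card ι := by
  rw [inner_hybridCharacterVector, norm_div, Complex.norm_natCast]
  gcongr
  exact norm_gaussSum_le_sqrt_card _ (by rwa [Ne, inv_mul_eq_one])

end HybridCharacter

/-- Let `p` be a prime and `n = p − 1 ≥ 2`.  Then there exist
`n + 1` orthonormal bases of `ℂ^n` such that any two vectors from distinct bases
have inner product of absolute value at most `√(n+1)/n`; since
`√(n+1)/n = n^{-1/2} + O(n^{-1})`, these form approximately mutually unbiased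
bases. -/
theorem amub_exists_dimension_prime_sub_one
    (p : ℕ) (hp : p.Prime) (n : ℕ) (hn : n = p - 1) (hn2 : 2 ≤ n) :
    ∃ B : Fin (n + 1) → Fin n → EuclideanSpace ℂ (Fin n),
      (∀ k, Orthonormal ℂ (B k) ∧
        Submodule.span ℂ (Set.range (B k)) = ⊤) ∧
      (∀ k l, k ≠ l → ∀ i j, ‖⟪B k i, B l j⟫‖ ≤ Real.sqrt (n + 1) / n) := by
  classical
  have : Fact p.Prime := ⟨hp⟩
  have hpn : p = n + 1 := by omega
  have : NeZero n := ⟨by omega⟩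
  have hunits : Nat.card (ZMod p)ˣ = n := by
    rw [Nat.card_eq_fintype_card, ZMod.card_units, hn]
  have hmul : Nat.card (MulChar (ZMod p) ℂ) = n := by
    rw [MulChar.card_eq_card_units_of_hasEnoughRootsOfUnity, hunits]
  have hadd : Nat.card (AddChar (ZMod p) ℂ) = n + 1 := by
    rw [Nat.card_eq_fintype_card, AddChar.card_eq, ZMod.card, hpn]
  have : Finite (MulChar (ZMod p) ℂ) := Nat.finite_of_card_ne_zero (by omega)
  let e : Fin n ≃ (ZMod p)ˣ := (Finite.equivFinOfCardEq hunits).symm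
  let f : Fin n ≃ MulChar (ZMod p) ℂ := (Finite.equivFinOfCardEq hmul).symm
  let g : Fin (n + 1) ≃ AddChar (ZMod p) ℂ := (Finite.equivFinOfCardEq hadd).symm
  refine ⟨fun k i => hybridCharacterVector e (g k) (f i), fun k => ?_, fun k l hkl i j => ?_⟩
  · have ho := (orthonormal_hybridCharacterVector e (g k)).comp f f.injective
    exact ⟨ho, ho.linearIndependent.span_eq_top_of_card_eq_finrank' (by simp)⟩
  · have h := norm_inner_hybridCharacterVector_le e (g.injective.ne hkl) (f i) (f j)
    rw [ZMod.card, Fintype.card_fin] at h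
    simpa [hpn] using h
end
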